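/- For all integers N and d with N ≥ d + 2 ≥ 4 (i.e., d ≥ 2 and N ≥ d + 2), the set 𝓖_{N,d}^ℝ of N×N real symmetric matrices P satisfying P² = P, rank P = d, and P_{nn} = d/N for every n ∈ {1, …, N}, is path-connected (as a subset of the space of N×N real matrices with its standard topology). -/

import Mathlib

noncomputable section

/-- The set `𝓖_{N,d}^ℝ` of rank-`d` real symmetric orthogonal projections on `ℝ^N` all of
whose diagonal entries equal `d/N`. -/
def ProjSet (N d : ℕ) : Set (Matrix (Fin N) (Fin N) ℝ) :=
  {P | P.transpose = P ∧ P * P = P ∧ P.rank = d ∧ ∀ n, P n n = (d : ℝ) / (N : ℝ)}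


section NormedPart
open scoped Matrix Topology

attribute [local instance] Matrix.normedAddCommGroup Matrix.normedSpace

/-- Isotropic orthonormal `j`-frames for the quadratic form `S`. -/
def IsoFr {N : ℕ} (S : Matrix (Fin N) (Fin N) ℝ) (j : ℕ) : Set (Fin j → Fin N → ℝ) :=
  {v | (∀ i k, v i ⬝ᵥ v k = if i = k then 1 else 0) ∧ ∀ i, v i ⬝ᵥ S *ᵥ v i = 0}

theorem cons_mem_isoFr {N : ℕ} {S : Matrix (Fin N) (Fin N) ℝ} {j : ℕ} {u : Fin N → ℝ}
    {v : Fin j → Fin N → ℝ} :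
    (Fin.cons u v : Fin (j + 1) → Fin N → ℝ) ∈ IsoFr S (j + 1) ↔
      v ∈ IsoFr S j ∧ u ⬝ᵥ u = 1 ∧ (∀ i, v i ⬝ᵥ u = 0) ∧ u ⬝ᵥ S *ᵥ u = 0 := by
  constructor
  · rintro ⟨h1, h2⟩
    refine ⟨⟨fun i k => ?_, fun i => ?_⟩, ?_, fun i => ?_, ?_⟩
    · simpa using h1 i.succ k.succ
    · simpa using h2 i.succ
    · simpa using h1 0 0
    · simpa [Fin.succ_ne_zero] using h1 i.succ 0
    · simpa using h2 0
  · rintro ⟨⟨h1, h2⟩, h3, h4, h5⟩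
    refine ⟨fun i k => ?_, fun i => ?_⟩
    · refine Fin.cases ?_ (fun i => ?_) i <;> refine Fin.cases ?_ (fun k => ?_) k
      · simpa using h3
      · rw [if_neg (Fin.succ_ne_zero k).symm]
        simpa [dotProduct_comm] using h4 k
      · rw [if_neg (Fin.succ_ne_zero i)]
        simpa using h4 i
      · simpa using h1 i k
    · refine Fin.cases ?_ (fun i => ?_) i
      · simpa using h5
      · simpa using h2 i

theorem an_sqrt {f : ℝ → ℝ} {t : ℝ} (hf : AnalyticAt ℝ f t) (h : f t ≠ 0) :
    AnalyticAt ℝ (fun s => √(f s)) t := by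
  have : AnalyticAt ℝ (fun x => √x) (f t) :=
    (Real.contDiffAt_sqrt (n := ⊤) h).analyticAt
  exact this.comp hf

theorem an_mat {m n : ℕ} {F : ℝ → Matrix (Fin m) (Fin n) ℝ} {t : ℝ} :
    AnalyticAt ℝ F t ↔ ∀ a b, AnalyticAt ℝ (fun s => F s a b) t := by
  have h1 : AnalyticAt ℝ F t ↔ ∀ a, AnalyticAt ℝ (fun s => F s a) t :=
    analyticAt_pi_iff (f := fun a s => F s a)
  rw [h1]
  refine forall_congr' fun a => ?_
  exact analyticAt_pi_iff (f := fun b s => F s a b)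

theorem an_vec {n : ℕ} {E : Type*} [NormedAddCommGroup E] [NormedSpace ℝ E]
    {F : ℝ → Fin n → E} {t : ℝ} :
    AnalyticAt ℝ F t ↔ ∀ a, AnalyticAt ℝ (fun s => F s a) t :=
  analyticAt_pi_iff (f := fun a s => F s a)

theorem an_dot {n : ℕ} {F G : ℝ → Fin n → ℝ} {t : ℝ} (hF : AnalyticAt ℝ F t)
    (hG : AnalyticAt ℝ G t) : AnalyticAt ℝ (fun s => F s ⬝ᵥ G s) t := by
  unfold dotProduct
  exact Finset.analyticAt_fun_sum _ fun i _ => (an_vec.1 hF i).fun_mul (an_vec.1 hG i)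

theorem an_mulVec {m n : ℕ} {F : ℝ → Matrix (Fin m) (Fin n) ℝ} {G : ℝ → Fin n → ℝ} {t : ℝ}
    (hF : AnalyticAt ℝ F t) (hG : AnalyticAt ℝ G t) : AnalyticAt ℝ (fun s => F s *ᵥ G s) t := by
  rw [an_vec]
  intro a
  unfold Matrix.mulVec dotProduct
  exact Finset.analyticAt_fun_sum _ fun i _ => (an_mat.1 hF a i).fun_mul (an_vec.1 hG i)

theorem an_mul {m n k : ℕ} {F : ℝ → Matrix (Fin m) (Fin n) ℝ} {G : ℝ → Matrix (Fin n) (Fin k) ℝ}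
    {t : ℝ} (hF : AnalyticAt ℝ F t) (hG : AnalyticAt ℝ G t) :
    AnalyticAt ℝ (fun s => F s * G s) t := by
  rw [an_mat]
  intro a b
  simp only [Matrix.mul_apply]
  exact Finset.analyticAt_fun_sum _ fun i _ => (an_mat.1 hF a i).fun_mul (an_mat.1 hG i b)

theorem an_cons {N j : ℕ} {u : ℝ → Fin N → ℝ} {f : ℝ → Fin j → Fin N → ℝ} {t : ℝ}
    (hu : AnalyticAt ℝ u t) (hf : AnalyticAt ℝ f t) :
    AnalyticAt ℝ (fun s => (Fin.cons (u s) (f s) : Fin (j + 1) → Fin N → ℝ)) t := by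
  rw [an_vec]
  intro a
  refine Fin.cases ?_ (fun i => ?_) a
  · simpa using hu
  · simpa using an_vec.1 hf i

/-- The projection onto the orthogonal complement of a frame. -/
def cproj {N j : ℕ} (v : Fin j → Fin N → ℝ) : Matrix (Fin N) (Fin N) ℝ :=
  1 - ∑ i, Matrix.vecMulVec (v i) (v i)

theorem cproj_symm {N j : ℕ} (v : Fin j → Fin N → ℝ) : (cproj v)ᵀ = cproj v := by
  simp [cproj, Matrix.transpose_sub, Matrix.transpose_sum, Matrix.transpose_vecMulVec]

theorem cproj_mulVec {N j : ℕ} (v : Fin j → Fin N → ℝ) (x : Fin N → ℝ) :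
    cproj v *ᵥ x = x - ∑ i, (v i ⬝ᵥ x) • v i := by
  simp [cproj, Matrix.sub_mulVec, Matrix.sum_mulVec, Matrix.vecMulVec_mulVec]

theorem cproj_perp {N j : ℕ} {S : Matrix (Fin N) (Fin N) ℝ} {v : Fin j → Fin N → ℝ}
    (hv : v ∈ IsoFr S j) (x : Fin N → ℝ) (i : Fin j) : v i ⬝ᵥ (cproj v *ᵥ x) = 0 := by
  rw [cproj_mulVec, dotProduct_sub, dotProduct_sum]
  simp [hv.1]

theorem cproj_idem {N j : ℕ} {S : Matrix (Fin N) (Fin N) ℝ} {v : Fin j → Fin N → ℝ}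
    (hv : v ∈ IsoFr S j) : cproj v * cproj v = cproj v := by
  apply Matrix.ext_of_mulVec_single
  intro k
  rw [← Matrix.mulVec_mulVec, cproj_mulVec v (cproj v *ᵥ _), Finset.sum_eq_zero, sub_zero]
  intro i _
  rw [cproj_perp hv, zero_smul]

theorem cproj_trace {N j : ℕ} {S : Matrix (Fin N) (Fin N) ℝ} {v : Fin j → Fin N → ℝ}
    (hv : v ∈ IsoFr S j) : (cproj v).trace = N - j := by
  simp [cproj, Matrix.trace_sub, Matrix.trace_sum, Matrix.trace_vecMulVec, hv.1]

theorem cproj_form_trace {N j : ℕ} {S : Matrix (Fin N) (Fin N) ℝ} (hT : S.trace = 0)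
    {v : Fin j → Fin N → ℝ}
    (hv : v ∈ IsoFr S j) : (cproj v * S * cproj v).trace = 0 := by
  rw [Matrix.trace_mul_comm, ← Matrix.mul_assoc, cproj_idem hv, Matrix.trace_mul_comm]
  have h : ∀ i, (S * Matrix.vecMulVec (v i) (v i)).trace = 0 := by
    intro i
    rw [Matrix.mul_vecMulVec, Matrix.trace_vecMulVec, dotProduct_comm]
    exact hv.2 i
  simp [cproj, Matrix.mul_sub, Matrix.mul_sum, hT, Matrix.trace_sum, h]

theorem form_conj {N : ℕ} {S C : Matrix (Fin N) (Fin N) ℝ} (hC : Cᵀ = C) (x : Fin N → ℝ) :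
    x ⬝ᵥ ((C * S * C) *ᵥ x) = (C *ᵥ x) ⬝ᵥ (S *ᵥ (C *ᵥ x)) := by
  rw [← Matrix.mulVec_mulVec, ← Matrix.mulVec_mulVec, Matrix.dotProduct_mulVec,
    ← Matrix.mulVec_transpose, hC]

theorem exists_pos_form {N : ℕ} {A : Matrix (Fin N) (Fin N) ℝ} (hs : Aᵀ = A)
    (ht : A.trace = 0) (h0 : A ≠ 0) : ∃ x, 0 < x ⬝ᵥ A *ᵥ x := by
  by_contra! h
  have : (-A).PosSemidef := by
    rw [Matrix.posSemidef_iff_dotProduct_mulVec]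
    refine ⟨?_, fun x => ?_⟩
    · simp [Matrix.IsHermitian, Matrix.conjTranspose_eq_transpose_of_trivial, hs]
    · simpa [Matrix.neg_mulVec] using h x
  have h2 := this.trace_eq_zero_iff.1 (by simp [ht])
  exact h0 (by simpa using h2)

theorem an_cproj {N j : ℕ} {f : ℝ → Fin j → Fin N → ℝ} {t : ℝ} (hf : AnalyticAt ℝ f t) :
    AnalyticAt ℝ (fun s => cproj (f s)) t := by
  rw [an_mat]
  intro a b
  simp only [cproj, Matrix.sub_apply, Matrix.sum_apply, Matrix.vecMulVec_apply]
  refine analyticAt_const.fun_sub ?_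
  refine Finset.analyticAt_fun_sum _ fun i _ => ?_
  exact (an_vec.1 (an_vec.1 hf i) a).fun_mul (an_vec.1 (an_vec.1 hf i) b)

theorem zero_of_punctured {E : Type*} [NormedAddCommGroup E] {h : ℝ → E} {t : ℝ}
    (hc : ContinuousAt h t) (h0 : ∀ᶠ s in 𝓝[≠] t, h s = 0) : h t = 0 := by
  have h1 : Filter.Tendsto h (𝓝[≠] t) (𝓝 (h t)) := hc.tendsto.mono_left nhdsWithin_le_nhds
  have h2 : Filter.Tendsto h (𝓝[≠] t) (𝓝 0) :=
    (tendsto_const_nhds (x := (0 : E))).congr' (by filter_upwards [h0] with s hs using hs.symm)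
  exact tendsto_nhds_unique h1 h2

theorem germ_vec {N : ℕ} {S : Matrix (Fin N) (Fin N) ℝ} (hS : Sᵀ = S) (hT : S.trace = 0)
    {j : ℕ} (hj : j < N) (f : ℝ → Fin j → Fin N → ℝ) (t : ℝ) (hf : AnalyticAt ℝ f t)
    (hV : ∀ᶠ s in 𝓝 t, f s ∈ IsoFr S j) :
    ∃ g : ℝ → Fin N → ℝ, AnalyticAt ℝ g t ∧ cproj (f t) *ᵥ g t ≠ 0 ∧
      ∀ᶠ s in 𝓝 t, g s ⬝ᵥ ((cproj (f s) * S * cproj (f s)) *ᵥ g s) = 0 := by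
  have hC := an_cproj hf
  have hA : AnalyticAt ℝ (fun s => cproj (f s) * S * cproj (f s)) t :=
    an_mul (an_mul hC analyticAt_const) hC
  by_cases hz : ∀ᶠ s in 𝓝 t, cproj (f s) * S * cproj (f s) = 0
  · have hne : cproj (f t) ≠ 0 := by
      intro h
      have h1 := cproj_trace hV.self_of_nhds
      rw [h, Matrix.trace_zero] at h1
      have : (j : ℝ) < N := by exact_mod_cast hj
      linarith
    have : ∃ x, cproj (f t) *ᵥ x ≠ 0 := by
      by_contra! h
      apply hne
      apply Matrix.ext_of_mulVec_single
      intro i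
      rw [h, Matrix.zero_mulVec]
    obtain ⟨x, hx⟩ := this
    refine ⟨fun _ => x, analyticAt_const, hx, ?_⟩
    filter_upwards [hz] with s hs
    rw [hs, Matrix.zero_mulVec, dotProduct_zero]
  · obtain ⟨r, B, hB, hB0, hAB⟩ := hA.exists_eventuallyEq_pow_smul_nonzero_iff.2 hz
    have hBA : ∀ᶠ s in 𝓝[≠] t, B s = ((s - t) ^ r)⁻¹ • (cproj (f s) * S * cproj (f s)) := by
      filter_upwards [hAB.filter_mono nhdsWithin_le_nhds, self_mem_nhdsWithin] with s h1 h2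
      have h3 : (s - t) ^ r ≠ 0 := pow_ne_zero _ (sub_ne_zero.2 h2)
      rw [h1, smul_smul, inv_mul_cancel₀ h3, one_smul]
    have hBs : (B t)ᵀ = B t := by
      rw [← sub_eq_zero]
      refine zero_of_punctured (h := fun s => (B s)ᵀ - B s) ?_ ?_
      · exact ((continuous_id.matrix_transpose).continuousAt.comp hB.continuousAt).sub hB.continuousAt
      · filter_upwards [hBA] with s hs
        rw [hs, Matrix.transpose_smul, Matrix.transpose_mul, Matrix.transpose_mul, cproj_symm, hS,
          Matrix.mul_assoc, sub_self]
    have hBt : (B t).trace = 0 := by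
      refine zero_of_punctured (h := fun s => (B s).trace) ?_ ?_
      · exact (continuous_id.matrix_trace).continuousAt.comp hB.continuousAt
      · filter_upwards [hBA, hV.filter_mono nhdsWithin_le_nhds] with s hs h2
        rw [hs, Matrix.trace_smul, cproj_form_trace hT h2, smul_zero]
    have hBC : B t * cproj (f t) = B t := by
      rw [← sub_eq_zero]
      refine zero_of_punctured (h := fun s => B s * cproj (f s) - B s) ?_ ?_
      · exact ((an_mul hB hC).continuousAt).sub hB.continuousAt
      · filter_upwards [hBA, hV.filter_mono nhdsWithin_le_nhds] with s hs h2
        rw [hs, Matrix.smul_mul, Matrix.mul_assoc, cproj_idem h2, sub_self]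
    obtain ⟨x, hx⟩ := exists_pos_form hBs hBt hB0
    obtain ⟨y, hy⟩ := exists_pos_form (A := -B t) (by rw [Matrix.transpose_neg, hBs])
      (by rw [Matrix.trace_neg, hBt, neg_zero]) (neg_ne_zero.2 hB0)
    rw [Matrix.neg_mulVec, dotProduct_neg] at hy
    have hform : ∀ a b : Fin N → ℝ, AnalyticAt ℝ (fun s => a ⬝ᵥ (B s *ᵥ b)) t := fun a b =>
      an_dot analyticAt_const (an_mulVec hB analyticAt_const)
    set p : ℝ → ℝ := fun s => x ⬝ᵥ (B s *ᵥ x) with hp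
    set q : ℝ → ℝ := fun s => (x ⬝ᵥ (B s *ᵥ y) + y ⬝ᵥ (B s *ᵥ x)) / 2 with hq
    set ρ : ℝ → ℝ := fun s => y ⬝ᵥ (B s *ᵥ y) with hρ
    set D : ℝ → ℝ := fun s => q s ^ 2 - p s * ρ s with hD
    have hpa : AnalyticAt ℝ p t := hform x x
    have hqa : AnalyticAt ℝ q t := ((hform x y).fun_add (hform y x)).fun_div analyticAt_const two_ne_zero
    have hρa : AnalyticAt ℝ ρ t := hform y y
    have hDa : AnalyticAt ℝ D t := (hqa.fun_pow 2).fun_sub (hpa.fun_mul hρa)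
    have hpt : 0 < p t := hx
    have hρt : ρ t < 0 := by simpa [hρ] using hy
    have hDt : 0 < D t := by
      have : p t * ρ t < 0 := mul_neg_of_pos_of_neg hpt hρt
      simp only [hD]; nlinarith [sq_nonneg (q t)]
    have hσ : AnalyticAt ℝ (fun s => (-q s - √(D s)) / ρ s) t :=
      (hqa.fun_neg.fun_sub (an_sqrt hDa hDt.ne')).fun_div hρa hρt.ne
    refine ⟨fun s => x + ((-q s - √(D s)) / ρ s) • y, ?_, ?_, ?_⟩
    · exact analyticAt_const.fun_add (hσ.fun_smul analyticAt_const)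
    · intro h0
      have h1 : B t *ᵥ (x + ((-q t - √(D t)) / ρ t) • y) = 0 := by
        rw [← hBC, ← Matrix.mulVec_mulVec, h0, Matrix.mulVec_zero]
      have h2 : y ⬝ᵥ B t *ᵥ (x + ((-q t - √(D t)) / ρ t) • y) = 0 := by rw [h1, dotProduct_zero]
      have h3 : y ⬝ᵥ B t *ᵥ x = x ⬝ᵥ B t *ᵥ y := by
        rw [Matrix.dotProduct_mulVec, ← Matrix.mulVec_transpose, hBs, dotProduct_comm]
      have h4 : q t = y ⬝ᵥ B t *ᵥ x := by simp only [hq]; rw [← h3]; ring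
      rw [Matrix.mulVec_add, Matrix.mulVec_smul, dotProduct_add, dotProduct_smul, ← h4, smul_eq_mul] at h2
      change q t + (-q t - √(D t)) / ρ t * ρ t = 0 at h2
      rw [div_mul_cancel₀ _ hρt.ne] at h2
      have := Real.sqrt_pos.2 hDt
      linarith
    · filter_upwards [hAB, hDa.continuousAt.eventually (lt_mem_nhds hDt),
        hρa.continuousAt.eventually (gt_mem_nhds hρt)] with s h1 h2 h3
      rw [h1, Matrix.smul_mulVec, dotProduct_smul]
      have : (x + ((-q s - √(D s)) / ρ s) • y) ⬝ᵥ B s *ᵥ (x + ((-q s - √(D s)) / ρ s) • y) = 0 := by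
        have e : (x + ((-q s - √(D s)) / ρ s) • y) ⬝ᵥ B s *ᵥ (x + ((-q s - √(D s)) / ρ s) • y)
            = p s + 2 * ((-q s - √(D s)) / ρ s) * q s + ((-q s - √(D s)) / ρ s) ^ 2 * ρ s := by
          simp only [Matrix.mulVec_add, Matrix.mulVec_smul, dotProduct_add, add_dotProduct,
            dotProduct_smul, smul_dotProduct, smul_eq_mul, hp, hq, hρ]
          ring
        rw [e]
        have h4 : √(D s) ^ 2 = q s ^ 2 - p s * ρ s := Real.sq_sqrt h2.le
        have h5 : ρ s ≠ 0 := h3.ne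
        generalize √(D s) = w at h4 ⊢
        field_simp
        linear_combination h4
      rw [this, smul_zero]

/-- Local analytic lifting of germs of isotropic frames. -/
theorem germ_lift {N : ℕ} {S : Matrix (Fin N) (Fin N) ℝ} (hS : Sᵀ = S) (hT : S.trace = 0)
    {j : ℕ} (hj : j < N) (f : ℝ → Fin j → Fin N → ℝ) (t : ℝ) (hf : AnalyticAt ℝ f t)
    (hV : ∀ᶠ s in 𝓝 t, f s ∈ IsoFr S j) :
    ∃ u : ℝ → Fin N → ℝ, AnalyticAt ℝ u t ∧
      ∀ᶠ s in 𝓝 t, (Fin.cons (u s) (f s) : Fin (j + 1) → Fin N → ℝ) ∈ IsoFr S (j + 1) := by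
  obtain ⟨g, hg, hg0, hgA⟩ := germ_vec hS hT hj f t hf hV
  have hw : AnalyticAt ℝ (fun s => cproj (f s) *ᵥ g s) t := an_mulVec (an_cproj hf) hg
  have hn : AnalyticAt ℝ (fun s => (cproj (f s) *ᵥ g s) ⬝ᵥ (cproj (f s) *ᵥ g s)) t := an_dot hw hw
  have hn0 : 0 < (cproj (f t) *ᵥ g t) ⬝ᵥ (cproj (f t) *ᵥ g t) := by
    have := Matrix.dotProduct_star_self_pos_iff.2 hg0
    simpa using this
  refine ⟨fun s => (√((cproj (f s) *ᵥ g s) ⬝ᵥ (cproj (f s) *ᵥ g s)))⁻¹ • (cproj (f s) *ᵥ g s),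
    ((an_sqrt hn hn0.ne').fun_inv (Real.sqrt_pos.2 hn0).ne').fun_smul hw, ?_⟩
  filter_upwards [hV, hgA, hn.continuousAt.eventually (lt_mem_nhds hn0)] with s h1 h2 h3
  rw [form_conj (cproj_symm _)] at h2
  refine cons_mem_isoFr.2 ⟨h1, ?_, fun i => ?_, ?_⟩
  · rw [smul_dotProduct, dotProduct_smul, smul_eq_mul, smul_eq_mul]
    have h4 := Real.sq_sqrt h3.le
    have h5 := Real.sqrt_pos.2 h3
    field_simp
    linarith
  · rw [dotProduct_smul, cproj_perp h1, smul_zero]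
  · rw [Matrix.mulVec_smul, smul_dotProduct, dotProduct_smul, h2, smul_zero, smul_zero]

/-- Analytic arcs of isotropic frames. -/
def Arc {N : ℕ} (S : Matrix (Fin N) (Fin N) ℝ) (j : ℕ) (v v' : Fin j → Fin N → ℝ) : Prop :=
  ∃ f : ℝ → Fin j → Fin N → ℝ,
    (∀ t ∈ Set.Icc (0 : ℝ) 1, AnalyticAt ℝ f t ∧ ∀ᶠ s in 𝓝 t, f s ∈ IsoFr S j) ∧
      f 0 = v ∧ f 1 = v'

def sflip {N j : ℕ} (i : Fin j) (v : Fin j → Fin N → ℝ) : Fin j → Fin N → ℝ :=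
  Function.update v i (-(v i))

theorem sflip_mem {N j : ℕ} {S : Matrix (Fin N) (Fin N) ℝ} (i : Fin j) {v : Fin j → Fin N → ℝ}
    (hv : v ∈ IsoFr S j) : sflip i v ∈ IsoFr S j := by
  refine ⟨fun a b => ?_, fun a => ?_⟩
  · have h := hv.1 a b
    by_cases ha : a = i <;> by_cases hb : b = i <;>
      simp_all [sflip, Function.update_apply]
    · have : ¬ i = b := fun h => hb h.symm
      simpa [this] using h
  · have h := hv.2 a
    by_cases ha : a = i <;> simp_all [sflip, Function.update_apply, Matrix.mulVec_neg]

theorem sflip_cons {N j : ℕ} (i : Fin j) (v : Fin j → Fin N → ℝ) (u : Fin N → ℝ) :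
    sflip i.succ (Fin.cons u v : Fin (j + 1) → Fin N → ℝ) = Fin.cons u (sflip i v) := by
  simp [sflip, Fin.cons_update]

theorem sflip_cons_zero {N j : ℕ} (v : Fin j → Fin N → ℝ) (u : Fin N → ℝ) :
    sflip 0 (Fin.cons u v : Fin (j + 1) → Fin N → ℝ) = Fin.cons (-u) v := by
  simp [sflip, Fin.update_cons_zero]

/-- Elementary moves. -/
def Rl {N : ℕ} (S : Matrix (Fin N) (Fin N) ℝ) (j : ℕ) (v v' : Fin j → Fin N → ℝ) : Prop :=
  Arc S j v v' ∨ (v ∈ IsoFr S j ∧ ∃ i, v' = sflip i v)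

theorem Arc.mem_left {N j : ℕ} {S : Matrix (Fin N) (Fin N) ℝ} {v v' : Fin j → Fin N → ℝ}
    (h : Arc S j v v') : v ∈ IsoFr S j := by
  obtain ⟨f, hf, rfl, rfl⟩ := h
  exact (hf 0 (by simp)).2.self_of_nhds

theorem Arc.mem_right {N j : ℕ} {S : Matrix (Fin N) (Fin N) ℝ} {v v' : Fin j → Fin N → ℝ}
    (h : Arc S j v v') : v' ∈ IsoFr S j := by
  obtain ⟨f, hf, rfl, rfl⟩ := h
  exact (hf 1 (by simp)).2.self_of_nhds

theorem germ_arc {N j : ℕ} {S : Matrix (Fin N) (Fin N) ℝ} {f : ℝ → Fin j → Fin N → ℝ} {t : ℝ}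
    (hf : AnalyticAt ℝ f t) (hV : ∀ᶠ s in 𝓝 t, f s ∈ IsoFr S j) :
    ∀ᶠ s in 𝓝 t, Arc S j (f t) (f s) := by
  have h1 : ∀ᶠ s in 𝓝 t, AnalyticAt ℝ f s ∧ ∀ᶠ r in 𝓝 s, f r ∈ IsoFr S j :=
    hf.eventually_analyticAt.and (eventually_eventually_nhds.2 hV)
  obtain ⟨ε, hε, hb⟩ := Metric.eventually_nhds_iff_ball.1 h1
  filter_upwards [Metric.ball_mem_nhds t hε] with s hs
  have hin : ∀ τ ∈ Set.Icc (0 : ℝ) 1, t + τ * (s - t) ∈ Metric.ball t ε := by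
    intro τ hτ
    rw [Metric.mem_ball, Real.dist_eq] at hs ⊢
    rw [add_sub_cancel_left, abs_mul, abs_of_nonneg hτ.1]
    calc τ * |s - t| ≤ 1 * |s - t| := by gcongr; exact hτ.2
      _ < ε := by rwa [one_mul]
  have ha : ∀ τ : ℝ, AnalyticAt ℝ (fun τ : ℝ => t + τ * (s - t)) τ := fun τ =>
    analyticAt_const.fun_add (analyticAt_id.fun_mul analyticAt_const)
  refine ⟨fun τ => f (t + τ * (s - t)), fun τ hτ => ⟨?_, ?_⟩, by simp, by simp⟩
  · exact AnalyticAt.comp (g := f) (f := fun τ : ℝ => t + τ * (s - t)) (hb _ (hin τ hτ)).1 (ha τ)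
  · exact (ha τ).continuousAt.eventually (hb _ (hin τ hτ)).2

/-- Normalization. -/
def nrm {N : ℕ} (x : Fin N → ℝ) : Fin N → ℝ := (√(x ⬝ᵥ x))⁻¹ • x

theorem nrm_unit {N : ℕ} {x : Fin N → ℝ} (h : x ⬝ᵥ x = 1) : nrm x = x := by simp [nrm, h]

theorem dot_self_pos {N : ℕ} {x : Fin N → ℝ} (h : x ≠ 0) : 0 < x ⬝ᵥ x := by
  have := Matrix.dotProduct_star_self_pos_iff.2 h
  simpa using this

theorem norm_arc {N j : ℕ} {S : Matrix (Fin N) (Fin N) ℝ} {v : Fin j → Fin N → ℝ}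
    (hv : v ∈ IsoFr S j) (p : ℝ → Fin N → ℝ) (hp : ∀ t, AnalyticAt ℝ p t)
    (hpv : ∀ t i, v i ⬝ᵥ p t = 0) (hpS : ∀ t, p t ⬝ᵥ S *ᵥ p t = 0)
    (hp0 : ∀ t ∈ Set.Icc (0 : ℝ) 1, p t ≠ 0) :
    Arc S (j + 1) (Fin.cons (nrm (p 0)) v) (Fin.cons (nrm (p 1)) v) := by
  refine ⟨fun t => Fin.cons (nrm (p t)) v, fun t ht => ?_, rfl, rfl⟩
  have hn := dot_self_pos (hp0 t ht)
  have hna : AnalyticAt ℝ (fun s => p s ⬝ᵥ p s) t := an_dot (hp t) (hp t)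
  refine ⟨an_cons ?_ analyticAt_const, ?_⟩
  · exact ((an_sqrt hna hn.ne').fun_inv (Real.sqrt_pos.2 hn).ne').fun_smul (hp t)
  · filter_upwards [hna.continuousAt.eventually (lt_mem_nhds hn)] with s h3
    refine cons_mem_isoFr.2 ⟨hv, ?_, fun i => ?_, ?_⟩
    · rw [nrm, smul_dotProduct, dotProduct_smul, smul_eq_mul, smul_eq_mul]
      have h4 := Real.sq_sqrt h3.le
      have h5 := Real.sqrt_pos.2 h3
      field_simp
      linarith
    · rw [nrm, dotProduct_smul, hpv, smul_zero]
    · rw [nrm, Matrix.mulVec_smul, smul_dotProduct, dotProduct_smul, hpS, smul_zero, smul_zero]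

theorem exists_perp {N j : ℕ} (h : j + 2 < N) (v : Fin j → Fin N → ℝ) (a b : Fin N → ℝ) :
    ∃ z, z ≠ 0 ∧ (∀ i, v i ⬝ᵥ z = 0) ∧ a ⬝ᵥ z = 0 ∧ b ⬝ᵥ z = 0 := by
  let M : Matrix (Fin (j + 1 + 1)) (Fin N) ℝ :=
    Matrix.of (Fin.cons a (Fin.cons b v : Fin (j + 1) → Fin N → ℝ) : Fin (j + 1 + 1) → Fin N → ℝ)
  have hk : LinearMap.ker M.mulVecLin ≠ ⊥ := by
    apply LinearMap.ker_ne_bot_of_finrank_lt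
    simpa using h
  obtain ⟨z, hz, hz0⟩ := Submodule.exists_mem_ne_zero_of_ne_bot hk
  have hz' : ∀ i, M i ⬝ᵥ z = 0 := fun i => congrFun (LinearMap.mem_ker.1 hz) i
  exact ⟨z, hz0, fun i => hz' i.succ.succ, hz' 0, hz' (Fin.succ 0)⟩

theorem symm_form {N : ℕ} {S : Matrix (Fin N) (Fin N) ℝ} (hS : Sᵀ = S) (x y : Fin N → ℝ) :
    x ⬝ᵥ S *ᵥ y = y ⬝ᵥ S *ᵥ x := by
  rw [Matrix.dotProduct_mulVec, ← Matrix.mulVec_transpose, hS, dotProduct_comm]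

theorem an_seg {N : ℕ} (x y : Fin N → ℝ) (t : ℝ) :
    AnalyticAt ℝ (fun t : ℝ => (1 - t) • x + t • y) t :=
  ((analyticAt_const.fun_sub analyticAt_id).fun_smul analyticAt_const).fun_add
    (analyticAt_id.fun_smul analyticAt_const)

theorem seg_arc {N j : ℕ} {S : Matrix (Fin N) (Fin N) ℝ} (hS : Sᵀ = S) {v : Fin j → Fin N → ℝ}
    (hv : v ∈ IsoFr S j) {x y : Fin N → ℝ} (hx : ∀ i, v i ⬝ᵥ x = 0) (hy : ∀ i, v i ⬝ᵥ y = 0)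
    (hxx : x ⬝ᵥ S *ᵥ x = 0) (hxy : x ⬝ᵥ S *ᵥ y = 0) (hyy : y ⬝ᵥ S *ᵥ y = 0)
    (h0 : ∀ t ∈ Set.Icc (0 : ℝ) 1, (1 - t) • x + t • y ≠ 0) :
    Arc S (j + 1) (Fin.cons (nrm x) v) (Fin.cons (nrm y) v) := by
  have := norm_arc hv (fun t : ℝ => (1 - t) • x + t • y) (an_seg x y)
    (fun t i => by rw [dotProduct_add, dotProduct_smul, dotProduct_smul, hx, hy]; simp)
    (fun t => by
      simp only [Matrix.mulVec_add, Matrix.mulVec_smul, dotProduct_add, add_dotProduct,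
            dotProduct_smul, smul_dotProduct, smul_eq_mul, hxx, hxy, hyy, symm_form hS y x]
      ring) h0
  simpa using this

theorem fiber_hyp {N j : ℕ} {S : Matrix (Fin N) (Fin N) ℝ} (hS : Sᵀ = S)
    {v : Fin j → Fin N → ℝ} {u u' z : Fin N → ℝ}
    (hu : (Fin.cons u v : Fin (j + 1) → Fin N → ℝ) ∈ IsoFr S (j + 1))
    (hu' : (Fin.cons u' v : Fin (j + 1) → Fin N → ℝ) ∈ IsoFr S (j + 1))
    (hz0 : z ≠ 0) (hzv : ∀ i, v i ⬝ᵥ z = 0) (hzu : z ⬝ᵥ S *ᵥ u = 0) (hzu' : z ⬝ᵥ S *ᵥ u' = 0)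
    (hβ : u ⬝ᵥ S *ᵥ u' ≠ 0) (hc : (u ⬝ᵥ S *ᵥ u') * (z ⬝ᵥ S *ᵥ z) ≤ 0) :
    Relation.EqvGen (Rl S (j + 1)) (Fin.cons u v) (Fin.cons u' v) := by
  obtain ⟨hv, hu1, hu2, hu3⟩ := cons_mem_isoFr.1 hu
  obtain ⟨-, hu1', hu2', hu3'⟩ := cons_mem_isoFr.1 hu'
  have hu'z : u' ⬝ᵥ S *ᵥ z = 0 := by rw [symm_form hS, hzu']
  have huz : u ⬝ᵥ S *ᵥ z = 0 := by rw [symm_form hS, hzu]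
  have hβ' : u' ⬝ᵥ S *ᵥ u = u ⬝ᵥ S *ᵥ u' := symm_form hS _ _
  obtain ⟨β, hβd⟩ : ∃ β, u ⬝ᵥ S *ᵥ u' = β := ⟨_, rfl⟩
  obtain ⟨c, hcd⟩ : ∃ c, z ⬝ᵥ S *ᵥ z = c := ⟨_, rfl⟩
  rw [hβd] at hβ' hβ hc
  rw [hcd] at hc
  by_cases hc0 : c = 0
  · have h1 : Arc S (j + 1) (Fin.cons (nrm u) v) (Fin.cons (nrm z) v) := by
      refine seg_arc hS hv hu2 hzv hu3 huz (hcd.trans hc0) fun t ht h => ?_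
      have h2 : u' ⬝ᵥ S *ᵥ ((1 - t) • u + t • z) = 0 := by rw [h, Matrix.mulVec_zero, dotProduct_zero]
      simp only [Matrix.mulVec_add, Matrix.mulVec_smul, dotProduct_add, dotProduct_smul,
        smul_eq_mul, hu'z, hβ', mul_zero, add_zero, mul_eq_zero, hβ, or_false] at h2
      have h3 : t = 1 := by linarith
      subst h3
      simp at h
      exact hz0 h
    have h2 : Arc S (j + 1) (Fin.cons (nrm u') v) (Fin.cons (nrm z) v) := by
      refine seg_arc hS hv hu2' hzv hu3' hu'z (hcd.trans hc0) fun t ht h => ?_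
      have h2 : u ⬝ᵥ S *ᵥ ((1 - t) • u' + t • z) = 0 := by rw [h, Matrix.mulVec_zero, dotProduct_zero]
      simp only [Matrix.mulVec_add, Matrix.mulVec_smul, dotProduct_add, dotProduct_smul,
        smul_eq_mul, huz, hβd] at h2
      simp only [mul_zero, add_zero, mul_eq_zero, hβ, or_false] at h2
      have h3 : t = 1 := by linarith
      subst h3
      simp at h
      exact hz0 h
    rw [nrm_unit hu1] at h1
    rw [nrm_unit hu1'] at h2
    refine Relation.EqvGen.trans _ (Fin.cons (nrm z) v) _ (.rel _ _ (Or.inl h1)) ?_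
    exact Relation.EqvGen.symm _ _ (.rel _ _ (Or.inl h2))
  · have hbc : 0 < -(2 * β / c) := by
      have : β * c < 0 := lt_of_le_of_ne hc (mul_ne_zero hβ hc0)
      have h2 : -(2 * β / c) = 2 * (-(β * c)) / c ^ 2 := by field_simp
      rw [h2]
      have h3 : 0 < -(β * c) := by linarith
      positivity
    set k := √(-(2 * β / c)) with hk
    have hk2 : k ^ 2 * c = -(2 * β) := by
      rw [hk, Real.sq_sqrt hbc.le]; field_simp
    have hct : ∀ t, AnalyticAt ℝ (fun t : ℝ => Real.cos (Real.pi / 2 * t)) t := fun t =>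
      Real.analyticAt_cos.comp (analyticAt_const.fun_mul analyticAt_id)
    have hst : ∀ t, AnalyticAt ℝ (fun t : ℝ => Real.sin (Real.pi / 2 * t)) t := fun t =>
      Real.analyticAt_sin.comp (analyticAt_const.fun_mul analyticAt_id)
    have := norm_arc hv (fun t : ℝ => Real.cos (Real.pi / 2 * t) ^ 2 • u +
        Real.sin (Real.pi / 2 * t) ^ 2 • u' +
        (k * (Real.cos (Real.pi / 2 * t) * Real.sin (Real.pi / 2 * t))) • z)
      (fun t => ((((hct t).fun_pow 2).fun_smul analyticAt_const).fun_add
        (((hst t).fun_pow 2).fun_smul analyticAt_const)).fun_add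
        ((analyticAt_const.fun_mul ((hct t).fun_mul (hst t))).fun_smul analyticAt_const))
      (fun t i => by simp [hu2, hu2', hzv])
      (fun t => by
        simp only [Matrix.mulVec_add, Matrix.mulVec_smul, dotProduct_add, add_dotProduct,
            dotProduct_smul, smul_dotProduct, smul_eq_mul, hu3, hu3', hu'z, huz, hzu, hzu', hβ',
            hβd, hcd]
        linear_combination (Real.cos (Real.pi / 2 * t) * Real.sin (Real.pi / 2 * t)) ^ 2 * hk2)
      (fun t ht h => by
        have e1 := congrArg (fun x => u ⬝ᵥ S *ᵥ x) h
        have e2 := congrArg (fun x => u' ⬝ᵥ S *ᵥ x) h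
        simp [Matrix.mulVec_add, Matrix.mulVec_smul, hu3, hu3', huz, hu'z, hβ', hβd, hβ] at e1 e2
        have e3 := Real.sin_sq_add_cos_sq (Real.pi / 2 * t)
        rw [e1, e2] at e3
        norm_num at e3)
    simp [nrm_unit hu1, nrm_unit hu1'] at this
    exact Relation.EqvGen.rel _ _ (Or.inl this)

theorem fiber_conn {N j : ℕ} {S : Matrix (Fin N) (Fin N) ℝ} (hS : Sᵀ = S) (hj : j + 2 < N)
    {v : Fin j → Fin N → ℝ} {u u' : Fin N → ℝ}
    (hu : (Fin.cons u v : Fin (j + 1) → Fin N → ℝ) ∈ IsoFr S (j + 1))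
    (hu' : (Fin.cons u' v : Fin (j + 1) → Fin N → ℝ) ∈ IsoFr S (j + 1)) :
    Relation.EqvGen (Rl S (j + 1)) (Fin.cons u v) (Fin.cons u' v) := by
  obtain ⟨hv, hu1, hu2, hu3⟩ := cons_mem_isoFr.1 hu
  obtain ⟨-, hu1', hu2', hu3'⟩ := cons_mem_isoFr.1 hu'
  by_cases hβ : u ⬝ᵥ S *ᵥ u' = 0
  · by_cases hn : u' = -u
    · refine Relation.EqvGen.rel _ _ (Or.inr ⟨hu, 0, ?_⟩)
      rw [sflip_cons_zero, hn]
    · have := seg_arc hS hv hu2 hu2' hu3 hβ hu3' (fun t ht h => by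
        have e : (1 - t) • u = -(t • u') := eq_neg_of_add_eq_zero_left h
        have e2 : ((1 - t) • u) ⬝ᵥ ((1 - t) • u) = (-(t • u')) ⬝ᵥ (-(t • u')) := by rw [e]
        simp [hu1, hu1'] at e2
        have e3 : t = 1 / 2 := by nlinarith
        subst e3
        apply hn
        have e4 : (1 / 2 : ℝ) • (u' + u) = 0 := by rw [smul_add, add_comm, ← h]; norm_num
        have e5 := (smul_eq_zero.1 e4).resolve_left (by norm_num)
        exact eq_neg_of_add_eq_zero_left e5)
      rw [nrm_unit hu1, nrm_unit hu1'] at this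
      exact Relation.EqvGen.rel _ _ (Or.inl this)
  · obtain ⟨z, hz0, hzv, hzu, hzu'⟩ := exists_perp hj v (S *ᵥ u) (S *ᵥ u')
    rw [dotProduct_comm] at hzu hzu'
    by_cases hc : (u ⬝ᵥ S *ᵥ u') * (z ⬝ᵥ S *ᵥ z) ≤ 0
    · exact fiber_hyp hS hu hu' hz0 hzv hzu hzu' hβ hc
    · have hm : (Fin.cons (-u') v : Fin (j + 1) → Fin N → ℝ) ∈ IsoFr S (j + 1) := by
        rw [← sflip_cons_zero]; exact sflip_mem _ hu'
      have h1 := fiber_hyp hS hu hm hz0 hzv hzu (by simp [Matrix.mulVec_neg, hzu'])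
        (by simpa [Matrix.mulVec_neg] using hβ) (by
          simp only [Matrix.mulVec_neg, dotProduct_neg]; push Not at hc; linarith)
      refine Relation.EqvGen.trans _ _ _ h1 (Relation.EqvGen.rel _ _ (Or.inr ⟨hm, 0, ?_⟩))
      rw [sflip_cons_zero, neg_neg]

theorem levels_conn {α : Type*} (L : ℝ → Set α) (R : α → α → Prop) (hR : Equivalence R)
    (hF : ∀ t ∈ Set.Icc (0 : ℝ) 1, ∀ w ∈ L t, ∀ w' ∈ L t, R w w')
    (hL : ∀ t ∈ Set.Icc (0 : ℝ) 1, ∀ᶠ s in 𝓝 t, ∃ w ∈ L t, ∃ w' ∈ L s, R w w') :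
    ∀ w ∈ L 0, ∀ w' ∈ L 1, R w w' := by
  have := isPreconnected_Icc (a := (0 : ℝ)) (b := 1) |>.induction₂
    (fun t s => ∀ w ∈ L t, ∀ w' ∈ L s, R w w') ?_ ?_ ?_ (x := 0) (y := 1) (by simp) (by simp)
  · exact this
  · intro t ht
    filter_upwards [mem_nhdsWithin_of_mem_nhds (hL t ht), self_mem_nhdsWithin] with s hs hs'
    obtain ⟨a, ha, b, hb, hab⟩ := hs
    intro w hw w' hw'
    exact hR.trans (hF t ht _ hw _ ha) (hR.trans hab (hF s hs' _ hb _ hw'))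
  · intro x y z _ hy _ hxy hyz w hw w' hw'
    obtain ⟨a, ha, -⟩ := (hL y hy).self_of_nhds
    exact hR.trans (hxy w hw a ha) (hyz a ha w' hw')
  · intro x y _ _ h w hw w' hw'
    exact hR.symm (h w' hw' w hw)

theorem isoFr_extend {N : ℕ} {S : Matrix (Fin N) (Fin N) ℝ} (hS : Sᵀ = S) (hT : S.trace = 0)
    {j : ℕ} (hj : j < N) {v : Fin j → Fin N → ℝ} (hv : v ∈ IsoFr S j) :
    ∃ u : Fin N → ℝ, (Fin.cons u v : Fin (j + 1) → Fin N → ℝ) ∈ IsoFr S (j + 1) := by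
  obtain ⟨u, -, hu⟩ := germ_lift hS hT hj (fun _ => v) 0 analyticAt_const
    (Filter.Eventually.of_forall fun _ => hv)
  exact ⟨u 0, hu.self_of_nhds⟩

theorem isoFr_nonempty {N : ℕ} {S : Matrix (Fin N) (Fin N) ℝ} (hS : Sᵀ = S) (hT : S.trace = 0)
    (j : ℕ) (hj : j ≤ N) : (IsoFr S j).Nonempty := by
  induction j with
  | zero => exact ⟨fun i => i.elim0, fun i => i.elim0, fun i => i.elim0⟩
  | succ j ih =>
    obtain ⟨v, hv⟩ := ih (by omega)
    obtain ⟨u, hu⟩ := isoFr_extend hS hT (by omega) hv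
    exact ⟨_, hu⟩

theorem sflip_sflip {N j : ℕ} (i : Fin j) (v : Fin j → Fin N → ℝ) : sflip i (sflip i v) = v := by
  simp [sflip]

theorem eqvGen_mem {N : ℕ} {S : Matrix (Fin N) (Fin N) ℝ} {j : ℕ} {v v' : Fin j → Fin N → ℝ}
    (h : Relation.EqvGen (Rl S j) v v') : v ∈ IsoFr S j ↔ v' ∈ IsoFr S j := by
  induction h with
  | rel x y h =>
    rcases h with h | ⟨h, i, rfl⟩
    · exact ⟨fun _ => h.mem_right, fun _ => h.mem_left⟩
    · exact ⟨fun _ => sflip_mem i h, fun _ => h⟩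
  | refl x => rfl
  | symm x y _ ih => exact ih.symm
  | trans x y z _ _ h1 h2 => exact h1.trans h2

theorem lift_step {N : ℕ} {S : Matrix (Fin N) (Fin N) ℝ} (hS : Sᵀ = S) (hT : S.trace = 0)
    {j : ℕ} (hj : j + 2 < N) {v v' : Fin j → Fin N → ℝ}
    (h : Relation.EqvGen (Rl S j) v v') (u u' : Fin N → ℝ)
    (hu : (Fin.cons u v : Fin (j + 1) → Fin N → ℝ) ∈ IsoFr S (j + 1))
    (hu' : (Fin.cons u' v' : Fin (j + 1) → Fin N → ℝ) ∈ IsoFr S (j + 1)) :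
    Relation.EqvGen (Rl S (j + 1)) (Fin.cons u v) (Fin.cons u' v') := by
  induction h generalizing u u' with
  | rel x y h =>
    rcases h with ⟨f, hf, rfl, rfl⟩ | ⟨h, i, rfl⟩
    · refine levels_conn (fun t => {w | ∃ u, w = Fin.cons u (f t) ∧ w ∈ IsoFr S (j + 1)})
        (Relation.EqvGen (Rl S (j + 1))) (Relation.EqvGen.is_equivalence _) ?_ ?_
        _ ⟨u, rfl, hu⟩ _ ⟨u', rfl, hu'⟩
      · rintro t ht _ ⟨a, rfl, ha⟩ _ ⟨b, rfl, hb⟩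
        exact fiber_conn hS hj ha hb
      · intro t ht
        obtain ⟨g, hg, hgV⟩ := germ_lift hS hT (by omega) f t (hf t ht).1 (hf t ht).2
        filter_upwards [germ_arc (an_cons hg (hf t ht).1) hgV] with s hs
        exact ⟨_, ⟨_, rfl, hs.mem_left⟩, _, ⟨_, rfl, hs.mem_right⟩, .rel _ _ (Or.inl hs)⟩
    · have h1 : (Fin.cons u (sflip i x) : Fin (j + 1) → Fin N → ℝ) ∈ IsoFr S (j + 1) := by
        rw [← sflip_cons]; exact sflip_mem _ hu
      refine .trans _ _ _ (.rel _ _ (Or.inr ⟨hu, i.succ, rfl⟩)) ?_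
      rw [sflip_cons]
      exact fiber_conn hS hj h1 hu'
  | refl x => exact fiber_conn hS hj hu hu'
  | symm x y _ ih => exact .symm _ _ (ih _ _ hu' hu)
  | trans x y z h1 h2 ih1 ih2 =>
    have hy := (eqvGen_mem h1).1 (cons_mem_isoFr.1 hu).1
    obtain ⟨a, ha⟩ := isoFr_extend hS hT (by omega) hy
    exact .trans _ _ _ (ih1 _ _ hu ha) (ih2 _ _ ha hu')

theorem tower_conn {N : ℕ} {S : Matrix (Fin N) (Fin N) ℝ} (hS : Sᵀ = S) (hT : S.trace = 0)
    (j : ℕ) (hj : j + 2 ≤ N) (v v' : Fin j → Fin N → ℝ) (hv : v ∈ IsoFr S j)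
    (hv' : v' ∈ IsoFr S j) : Relation.EqvGen (Rl S j) v v' := by
  induction j with
  | zero => rw [Subsingleton.elim v v']; exact .refl _
  | succ j ih =>
    rw [← Fin.cons_self_tail v] at hv ⊢
    rw [← Fin.cons_self_tail v'] at hv' ⊢
    exact lift_step hS hT (by omega)
      (ih (by omega) _ _ (cons_mem_isoFr.1 hv).1 (cons_mem_isoFr.1 hv').1) _ _ hv hv'

theorem cproj_full {N : ℕ} {S : Matrix (Fin N) (Fin N) ℝ} {w : Fin N → Fin N → ℝ}
    (hw : w ∈ IsoFr S N) (x : Fin N → ℝ) : x = ∑ i, (w i ⬝ᵥ x) • w i := by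
  have h1 : (Matrix.of w) * (Matrix.of w)ᵀ = 1 := by
    ext a b
    have := hw.1 a b
    simpa [Matrix.mul_apply, dotProduct, Matrix.one_apply] using this
  have h2 : (Matrix.of w)ᵀ * (Matrix.of w) = 1 := mul_eq_one_comm.1 h1
  have h3 : x = (Matrix.of w)ᵀ *ᵥ (Matrix.of w *ᵥ x) := by
    rw [Matrix.mulVec_mulVec, h2, Matrix.one_mulVec]
  conv_lhs => rw [h3]
  ext k
  simp [Matrix.mulVec, dotProduct, mul_comm]

theorem last_fiber {j : ℕ} {S : Matrix (Fin (j + 2)) (Fin (j + 2)) ℝ} (hS : Sᵀ = S)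
    (R : (Fin (j + 2) → Fin (j + 2) → ℝ) → (Fin (j + 2) → Fin (j + 2) → ℝ) → Prop)
    (hR : Equivalence R) (hA : ∀ w w', Arc S (j + 2) w w' → R w w')
    (hf : ∀ w ∈ IsoFr S (j + 2), ∀ i, R w (sflip i w))
    (hs : ∀ w ∈ IsoFr S (j + 2), R w (w ∘ Equiv.swap 0 1))
    {v : Fin j → Fin (j + 2) → ℝ} {a b a' b' : Fin (j + 2) → ℝ}
    (h : (Fin.cons a (Fin.cons b v : Fin (j + 1) → _) : Fin (j + 2) → _) ∈ IsoFr S (j + 2))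
    (h' : (Fin.cons a' (Fin.cons b' v : Fin (j + 1) → _) : Fin (j + 2) → _) ∈ IsoFr S (j + 2)) :
    R (Fin.cons a (Fin.cons b v : Fin (j + 1) → _) : Fin (j + 2) → _)
      (Fin.cons a' (Fin.cons b' v : Fin (j + 1) → _) : Fin (j + 2) → _) := by
  have key1 : ∀ a b b' : Fin (j + 2) → ℝ,
      (Fin.cons a (Fin.cons b v : Fin (j + 1) → _) : Fin (j + 2) → _) ∈ IsoFr S (j + 2) →
      (Fin.cons a (Fin.cons b' v : Fin (j + 1) → _) : Fin (j + 2) → _) ∈ IsoFr S (j + 2) →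
      R (Fin.cons a (Fin.cons b v : Fin (j + 1) → _) : Fin (j + 2) → _)
        (Fin.cons a (Fin.cons b' v : Fin (j + 1) → _) : Fin (j + 2) → _) := by
    intro a b b' h h'
    obtain ⟨hb, -, hab, -⟩ := cons_mem_isoFr.1 h
    obtain ⟨hb', -, hab', -⟩ := cons_mem_isoFr.1 h'
    obtain ⟨hv, hb1, hb2, hb3⟩ := cons_mem_isoFr.1 hb
    obtain ⟨-, hb1', hb2', hb3'⟩ := cons_mem_isoFr.1 hb'
    have e := cproj_full h b'
    have e1 : a ⬝ᵥ b' = 0 := by rw [dotProduct_comm]; simpa using hab' 0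
    simp only [Fin.sum_univ_succ, Fin.cons_zero, Fin.cons_succ, hb2', e1] at e
    simp only [zero_smul, Finset.sum_const_zero, add_zero, zero_add] at e
    have e2 : (b ⬝ᵥ b') * (b ⬝ᵥ b') = 1 := by
      have : (b ⬝ᵥ b') * (b ⬝ᵥ b') = b' ⬝ᵥ b' := by
        conv_rhs => rw [e]
        rw [smul_dotProduct, dotProduct_smul, hb1]
        simp
      rw [this, hb1']
    rcases mul_self_eq_one_iff.1 e2 with e3 | e3
    · rw [e3, one_smul] at e
      rw [e]; exact hR.refl _
    · rw [e3, neg_one_smul] at e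
      have := hf _ h (Fin.succ 0)
      rwa [sflip_cons, sflip_cons_zero, ← e] at this
  obtain ⟨hb, ha1, hab, ha3⟩ := cons_mem_isoFr.1 h
  obtain ⟨hb', ha1', hab', ha3'⟩ := cons_mem_isoFr.1 h'
  obtain ⟨hv, hb1, hb2, hb3⟩ := cons_mem_isoFr.1 hb
  have e := cproj_full h a'
  have hva' : ∀ i, v i ⬝ᵥ a' = 0 := fun i => by simpa using hab' i.succ
  have hva : ∀ i, v i ⬝ᵥ a = 0 := fun i => by simpa using hab i.succ
  have hba : b ⬝ᵥ a = 0 := by simpa using hab 0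
  have hab0 : a ⬝ᵥ b = 0 := by rw [dotProduct_comm]; exact hba
  simp only [Fin.sum_univ_succ, Fin.cons_zero, Fin.cons_succ, hva'] at e
  simp only [zero_smul, Finset.sum_const_zero, add_zero] at e
  set α := a ⬝ᵥ a'
  set β := b ⬝ᵥ a'
  have hnorm : α ^ 2 + β ^ 2 = 1 := by
    have := ha1'
    rw [e] at this
    simp only [add_dotProduct, dotProduct_add, smul_dotProduct, dotProduct_smul, ha1, hb1, hba,
      hab0, smul_eq_mul] at this
    linarith
  have hiso : α * β * (a ⬝ᵥ S *ᵥ b) = 0 := by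
    have := ha3'
    rw [e] at this
    simp only [Matrix.mulVec_add, Matrix.mulVec_smul, add_dotProduct, dotProduct_add,
      smul_dotProduct, dotProduct_smul, ha3, hb3, symm_form hS b a, smul_eq_mul] at this
    linarith
  have rot : ∀ θ : ℝ, (a ⬝ᵥ S *ᵥ b) = 0 →
      (Fin.cons (Real.cos θ • a + Real.sin θ • b)
        (Fin.cons (-Real.sin θ • a + Real.cos θ • b) v : Fin (j + 1) → _) : Fin (j + 2) → _)
          ∈ IsoFr S (j + 2) := by
    intro θ h0
    have h0' : b ⬝ᵥ S *ᵥ a = 0 := by rw [symm_form hS]; exact h0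
    have hcs := Real.sin_sq_add_cos_sq θ
    refine cons_mem_isoFr.2 ⟨cons_mem_isoFr.2 ⟨hv, ?_, ?_, ?_⟩, ?_, ?_, ?_⟩
    · simp only [add_dotProduct, dotProduct_add, smul_dotProduct, dotProduct_smul, ha1, hb1, hba,
        hab0, smul_eq_mul]
      linarith
    · intro i
      simp [hva, hb2]
    · simp only [Matrix.mulVec_add, Matrix.mulVec_smul, add_dotProduct, dotProduct_add,
        smul_dotProduct, dotProduct_smul, ha3, hb3, h0, h0', smul_eq_mul]
      ring
    · simp only [add_dotProduct, dotProduct_add, smul_dotProduct, dotProduct_smul, ha1, hb1, hba,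
        hab0, smul_eq_mul]
      linarith
    · intro i
      refine Fin.cases ?_ (fun i => ?_) i
      · simp only [Fin.cons_zero, add_dotProduct, dotProduct_add, smul_dotProduct, dotProduct_smul,
          ha1, hb1, hba, hab0, smul_eq_mul]
        ring
      · simp [hva, hb2]
    · simp only [Matrix.mulVec_add, Matrix.mulVec_smul, add_dotProduct, dotProduct_add,
        smul_dotProduct, dotProduct_smul, ha3, hb3, h0, h0', smul_eq_mul]
      ring
  by_cases h0 : a ⬝ᵥ S *ᵥ b = 0
  · obtain ⟨θ, hθ1, hθ2⟩ : ∃ θ : ℝ, α = Real.cos θ ∧ β = Real.sin θ := by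
      refine ⟨Complex.arg ⟨α, β⟩, ?_, ?_⟩
      · have hz : (⟨α, β⟩ : ℂ) ≠ 0 := by
          intro hz
          have h1 := congrArg Complex.re hz
          have h2 := congrArg Complex.im hz
          simp at h1 h2
          rw [h1, h2] at hnorm; norm_num at hnorm
        rw [Complex.cos_arg hz, Complex.norm_def, Complex.normSq_mk]
        rw [show α * α + β * β = 1 by linarith]; simp
      · rw [Complex.sin_arg, Complex.norm_def, Complex.normSq_mk]
        rw [show α * α + β * β = 1 by linarith]; simp
    have harc := hA _ _ (⟨fun t => (Fin.cons (Real.cos (t * θ) • a + Real.sin (t * θ) • b)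
        (Fin.cons (-Real.sin (t * θ) • a + Real.cos (t * θ) • b) v : Fin (j + 1) → _) :
          Fin (j + 2) → _), ?_, rfl, rfl⟩ : Arc S (j + 2) _ _)
    · simp only [zero_mul, one_mul, Real.cos_zero, Real.sin_zero, one_smul, zero_smul, neg_zero,
        add_zero, zero_add, ← hθ1, ← hθ2, ← e] at harc
      refine hR.trans harc (key1 _ _ _ ?_ h')
      have := rot θ h0
      rwa [← hθ1, ← hθ2, ← e] at this
    · intro t _
      refine ⟨?_, Filter.Eventually.of_forall fun s => rot _ h0⟩
      have hm : AnalyticAt ℝ (fun t : ℝ => t * θ) t := analyticAt_id.fun_mul analyticAt_const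
      have hc : AnalyticAt ℝ (fun t : ℝ => Real.cos (t * θ)) t := Real.analyticAt_cos.comp hm
      have hsn : AnalyticAt ℝ (fun t : ℝ => Real.sin (t * θ)) t := Real.analyticAt_sin.comp hm
      refine an_cons ?_ (an_cons ?_ analyticAt_const)
      · exact (hc.fun_smul analyticAt_const).fun_add (hsn.fun_smul analyticAt_const)
      · exact (hsn.fun_neg.fun_smul analyticAt_const).fun_add (hc.fun_smul analyticAt_const)
  · have h1 : α * β = 0 := by
      rcases mul_eq_zero.1 hiso with h1 | h1
      · exact h1
      · exact absurd h1 h0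
    have key2 : ∀ a b : Fin (j + 2) → ℝ, ∀ γ : ℝ, γ ^ 2 = 1 → a' = γ • a →
      (Fin.cons a (Fin.cons b v : Fin (j + 1) → _) : Fin (j + 2) → _) ∈ IsoFr S (j + 2) →
      R (Fin.cons a (Fin.cons b v : Fin (j + 1) → _) : Fin (j + 2) → _)
        (Fin.cons a' (Fin.cons b' v : Fin (j + 1) → _) : Fin (j + 2) → _) := by
      intro a b γ hγ ha' hh
      rcases mul_self_eq_one_iff.1 (by rw [← sq]; exact hγ : γ * γ = 1) with hγ | hγ
      · rw [hγ, one_smul] at ha'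
        rw [ha'] at h' ⊢
        exact key1 _ _ _ hh h'
      · rw [hγ, neg_one_smul] at ha'
        rw [ha'] at h' ⊢
        have := hf _ hh 0
        have hm := sflip_mem 0 hh
        rw [sflip_cons_zero] at this hm
        exact hR.trans this (key1 _ _ _ hm h')
    rcases mul_eq_zero.1 h1 with h1 | h1
    · rw [h1, zero_smul, zero_add] at e
      have e5 := hs _ h
      have e4 : (Fin.cons a (Fin.cons b v : Fin (j + 1) → _) : Fin (j + 2) → _) ∘ Equiv.swap 0 1 =
          (Fin.cons b (Fin.cons a v : Fin (j + 1) → _) : Fin (j + 2) → _) := by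
        funext i
        refine Fin.cases ?_ (fun i => Fin.cases ?_ (fun i => ?_) i) i
        · simp only [Function.comp_apply, Equiv.swap_apply_left, Fin.cons_zero]
          rfl
        · simp only [Function.comp_apply, Fin.succ_zero_eq_one, Equiv.swap_apply_right]
          rfl
        · rw [Function.comp_apply, Equiv.swap_apply_of_ne_of_ne]
          · simp
          · exact Fin.succ_ne_zero _
          · rw [← Fin.succ_zero_eq_one]
            exact fun hh => Fin.succ_ne_zero _ (Fin.succ_injective _ hh)
      rw [e4] at e5
      refine hR.trans e5 (key2 b a β (by rw [h1] at hnorm; linarith) e ?_)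
      refine cons_mem_isoFr.2 ⟨cons_mem_isoFr.2 ⟨hv, ha1, hva, ha3⟩, hb1, fun i => ?_, hb3⟩
      refine Fin.cases ?_ (fun i => ?_) i
      · simpa using hab0
      · simpa using hb2 i
    · rw [h1, zero_smul, add_zero] at e
      exact key2 a b α (by rw [h1] at hnorm; linarith) e h

theorem last_step {j : ℕ} {S : Matrix (Fin (j + 2)) (Fin (j + 2)) ℝ} (hS : Sᵀ = S)
    (hT : S.trace = 0)
    (R : (Fin (j + 2) → Fin (j + 2) → ℝ) → (Fin (j + 2) → Fin (j + 2) → ℝ) → Prop)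
    (hR : Equivalence R) (hA : ∀ w w', Arc S (j + 2) w w' → R w w')
    (hf : ∀ w ∈ IsoFr S (j + 2), ∀ i, R w (sflip i w))
    (hs : ∀ w ∈ IsoFr S (j + 2), R w (w ∘ Equiv.swap 0 1))
    {v v' : Fin j → Fin (j + 2) → ℝ} (hvv : Relation.EqvGen (Rl S j) v v')
    (a b a' b' : Fin (j + 2) → ℝ)
    (h : (Fin.cons a (Fin.cons b v : Fin (j + 1) → _) : Fin (j + 2) → _) ∈ IsoFr S (j + 2))
    (h' : (Fin.cons a' (Fin.cons b' v' : Fin (j + 1) → _) : Fin (j + 2) → _) ∈ IsoFr S (j + 2)) :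
    R (Fin.cons a (Fin.cons b v : Fin (j + 1) → _) : Fin (j + 2) → _)
      (Fin.cons a' (Fin.cons b' v' : Fin (j + 1) → _) : Fin (j + 2) → _) := by
  induction hvv generalizing a b a' b' with
  | rel x y hxy =>
    rcases hxy with ⟨f, hff, rfl, rfl⟩ | ⟨hx, i, rfl⟩
    · refine levels_conn (fun t => {w | ∃ a b : Fin (j + 2) → ℝ,
          w = (Fin.cons a (Fin.cons b (f t) : Fin (j + 1) → _) : Fin (j + 2) → _) ∧
            w ∈ IsoFr S (j + 2)}) R hR ?_ ?_ _ ⟨a, b, rfl, h⟩ _ ⟨a', b', rfl, h'⟩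
      · rintro t ht _ ⟨a, b, rfl, ha⟩ _ ⟨a', b', rfl, hb⟩
        exact last_fiber hS R hR hA hf hs ha hb
      · intro t ht
        obtain ⟨g, hg, hgV⟩ := germ_lift hS hT (by omega) f t (hff t ht).1 (hff t ht).2
        obtain ⟨g', hg', hgV'⟩ := germ_lift hS hT (by omega) _ t (an_cons hg (hff t ht).1) hgV
        filter_upwards [germ_arc (an_cons hg' (an_cons hg (hff t ht).1)) hgV'] with s hs
        exact ⟨_, ⟨_, _, rfl, hs.mem_left⟩, _, ⟨_, _, rfl, hs.mem_right⟩, hA _ _ hs⟩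
    · have h1 := hf _ h i.succ.succ
      have h2 := sflip_mem i.succ.succ h
      rw [sflip_cons, sflip_cons] at h1 h2
      exact hR.trans h1 (last_fiber hS R hR hA hf hs h2 h')
  | refl x => exact last_fiber hS R hR hA hf hs h h'
  | symm x y _ ih => exact hR.symm (ih _ _ _ _ h' h)
  | trans x y z h1 h2 ih1 ih2 =>
    have hx := (cons_mem_isoFr.1 (cons_mem_isoFr.1 h).1).1
    have hy := (eqvGen_mem h1).1 hx
    obtain ⟨c, hc⟩ := isoFr_extend hS hT (by omega) hy
    obtain ⟨e, he⟩ := isoFr_extend hS hT (by omega) hc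
    exact hR.trans (ih1 _ _ _ _ h he) (ih2 _ _ _ _ he h')

theorem all_conn {j : ℕ} {S : Matrix (Fin (j + 2)) (Fin (j + 2)) ℝ} (hS : Sᵀ = S)
    (hT : S.trace = 0)
    (R : (Fin (j + 2) → Fin (j + 2) → ℝ) → (Fin (j + 2) → Fin (j + 2) → ℝ) → Prop)
    (hR : Equivalence R) (hA : ∀ w w', Arc S (j + 2) w w' → R w w')
    (hf : ∀ w ∈ IsoFr S (j + 2), ∀ i, R w (sflip i w))
    (hs : ∀ w ∈ IsoFr S (j + 2), R w (w ∘ Equiv.swap 0 1))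
    (w w' : Fin (j + 2) → Fin (j + 2) → ℝ) (hw : w ∈ IsoFr S (j + 2))
    (hw' : w' ∈ IsoFr S (j + 2)) : R w w' := by
  have e : ∀ w : Fin (j + 2) → Fin (j + 2) → ℝ, w = (Fin.cons (w 0)
      (Fin.cons (w 1) (Fin.tail (Fin.tail w)) : Fin (j + 1) → _) : Fin (j + 2) → _) := by
    intro w
    conv_lhs => rw [← Fin.cons_self_tail w, ← Fin.cons_self_tail (Fin.tail w)]
    rfl
  rw [e w] at hw ⊢
  rw [e w'] at hw' ⊢
  refine last_step hS hT R hR hA hf hs (tower_conn hS hT j le_rfl _ _ ?_ ?_) _ _ _ _ hw hw'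
  · exact (cons_mem_isoFr.1 (cons_mem_isoFr.1 hw).1).1
  · exact (cons_mem_isoFr.1 (cons_mem_isoFr.1 hw').1).1

end NormedPart

open scoped Matrix Topology

theorem joined_map {X Y : Type*} [TopologicalSpace X] [TopologicalSpace Y] {F : Set X} {G : Set Y}
    {x y : X} (h : JoinedIn F x y) {f : X → Y} (hf : Continuous f) (hm : ∀ z ∈ F, f z ∈ G) :
    JoinedIn G (f x) (f y) :=
  (h.map hf).mono (by rintro _ ⟨z, hz, rfl⟩; exact hm z hz)

theorem mem_projSet {N d : ℕ} (hN : 0 < N) {P : Matrix (Fin N) (Fin N) ℝ} (h1 : Pᵀ = P)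
    (h2 : P * P = P) (h3 : ∀ n, P n n = (d : ℝ) / (N : ℝ)) : P ∈ ProjSet N d := by
  refine ⟨h1, h2, ?_, h3⟩
  have hid : IsIdempotentElem (Matrix.toLin' P) := by
    rw [IsIdempotentElem, Module.End.mul_eq_comp, ← Matrix.toLin'_mul, h2]
  have ht := (LinearMap.IsIdempotentElem.isProj_range _ hid).trace
  rw [Matrix.trace_toLin'_eq] at ht
  have : P.trace = d := by
    simp only [Matrix.trace, Matrix.diag_apply, h3]
    simp
    field_simp
  rw [this] at ht
  have hr : P.rank = Module.finrank ℝ (LinearMap.range (Matrix.toLin' P)) := by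
    rw [Matrix.rank, Matrix.toLin'_apply']
  rw [hr]
  exact_mod_cast ht.symm

theorem spec_idem {N : ℕ} {P : Matrix (Fin N) (Fin N) ℝ} (h1 : Pᵀ = P) (h2 : P * P = P) :
    ∃ (V : Matrix (Fin N) (Fin N) ℝ) (l : Fin N → ℝ), V * Vᵀ = 1 ∧ P = V * Matrix.diagonal l * Vᵀ ∧
      (∀ i, l i = 0 ∨ l i = 1) ∧ P.rank = Fintype.card {i // l i ≠ 0} := by
  have hH : P.IsHermitian := by
    simp [Matrix.IsHermitian, Matrix.conjTranspose_eq_transpose_of_trivial, h1]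
  have hV : (hH.eigenvectorUnitary : Matrix (Fin N) (Fin N) ℝ) *
      (hH.eigenvectorUnitary : Matrix (Fin N) (Fin N) ℝ)ᵀ = 1 := by
    have := Unitary.mul_star_self_of_mem hH.eigenvectorUnitary.2
    simpa [Matrix.star_eq_conjTranspose, Matrix.conjTranspose_eq_transpose_of_trivial] using this
  have hP : P = (hH.eigenvectorUnitary : Matrix (Fin N) (Fin N) ℝ) *
      Matrix.diagonal hH.eigenvalues * (hH.eigenvectorUnitary : Matrix (Fin N) (Fin N) ℝ)ᵀ := by
    have := hH.spectral_theorem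
    rw [Unitary.conjStarAlgAut_apply] at this
    simpa [Matrix.star_eq_conjTranspose, Matrix.conjTranspose_eq_transpose_of_trivial,
      Function.comp_def] using this
  refine ⟨hH.eigenvectorUnitary, hH.eigenvalues, hV, hP, ?_, hH.rank_eq_card_non_zero_eigs⟩
  set V := (hH.eigenvectorUnitary : Matrix (Fin N) (Fin N) ℝ)
  have hV' : Vᵀ * V = 1 := mul_eq_one_comm.1 hV
  have hD : Matrix.diagonal hH.eigenvalues = Vᵀ * P * V := by
    conv_rhs => rw [hP]
    calc _ = (Vᵀ * V) * Matrix.diagonal hH.eigenvalues * (Vᵀ * V) := by rw [hV']; simp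
      _ = _ := by simp only [Matrix.mul_assoc]
  have hDD : Matrix.diagonal hH.eigenvalues * Matrix.diagonal hH.eigenvalues
      = Matrix.diagonal hH.eigenvalues := by
    rw [hD]
    calc _ = Vᵀ * (P * (V * Vᵀ) * P) * V := by simp only [Matrix.mul_assoc]
      _ = _ := by rw [hV, Matrix.mul_one, h2]
  intro i
  have := congrFun (congrFun hDD i) i
  simp only [Matrix.diagonal_mul_diagonal, Matrix.diagonal_apply_eq] at this
  have h0 : hH.eigenvalues i * (hH.eigenvalues i - 1) = 0 := by linarith
  rcases mul_eq_zero.1 h0 with h | h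
  · exact Or.inl h
  · exact Or.inr (by linarith)

theorem conj_exists {N : ℕ} {P Q : Matrix (Fin N) (Fin N) ℝ} (h1 : Pᵀ = P) (h2 : P * P = P)
    (h1' : Qᵀ = Q) (h2' : Q * Q = Q) (hr : P.rank = Q.rank) :
    ∃ W : Matrix (Fin N) (Fin N) ℝ, W * Wᵀ = 1 ∧ Q = W * P * Wᵀ := by
  obtain ⟨V, l, hV, hP, hl, hlr⟩ := spec_idem h1 h2
  obtain ⟨U, m, hU, hQ, hm, hmr⟩ := spec_idem h1' h2'
  let e : {i // l i ≠ 0} ≃ {i // m i ≠ 0} := Fintype.equivOfCardEq (by rw [← hlr, ← hmr, hr])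
  let σ : Equiv.Perm (Fin N) := e.extendSubtype
  have hσ : ∀ i, m (σ i) = l i := by
    intro i
    by_cases h : l i ≠ 0
    · have := e.extendSubtype_mem i h
      rw [(hm _).resolve_left this, (hl i).resolve_left h]
    · have := e.extendSubtype_not_mem i h
      push Not at this h
      rw [h, this]
  have hV' : Vᵀ * V = 1 := mul_eq_one_comm.1 hV
  let U' := U.submatrix id σ
  have hU' : U' * U'ᵀ = 1 := by
    rw [← hU]
    ext a b
    simp only [Matrix.mul_apply, U', Matrix.submatrix_apply, Matrix.transpose_apply, id]
    exact Equiv.sum_comp σ (fun k => U a k * U b k)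
  have hQ' : Q = U' * Matrix.diagonal l * U'ᵀ := by
    rw [hQ]
    ext a b
    rw [Matrix.mul_apply, Matrix.mul_apply]
    simp only [U', Matrix.submatrix_apply, Matrix.transpose_apply, id,
      Matrix.mul_diagonal, ← hσ]
    exact (Equiv.sum_comp σ (fun k => U a k * m k * U b k)).symm
  refine ⟨U' * Vᵀ, ?_, ?_⟩
  · rw [Matrix.transpose_mul, Matrix.transpose_transpose]
    calc _ = U' * (Vᵀ * V) * U'ᵀ := by simp only [Matrix.mul_assoc]
      _ = 1 := by rw [hV', Matrix.mul_one, hU']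
  · rw [Matrix.transpose_mul, Matrix.transpose_transpose, hP, hQ']
    calc _ = U' * ((Vᵀ * V) * Matrix.diagonal l * (Vᵀ * V)) * U'ᵀ := by rw [hV']; simp
      _ = _ := by simp only [Matrix.mul_assoc]

/-- The Gram matrix of a family of vectors with respect to `P`. -/
def gramP {N : ℕ} (P : Matrix (Fin N) (Fin N) ℝ) (w : Fin N → Fin N → ℝ) :
    Matrix (Fin N) (Fin N) ℝ := fun a b => w a ⬝ᵥ P *ᵥ w b

theorem gramP_eq {N : ℕ} (P : Matrix (Fin N) (Fin N) ℝ) (w : Fin N → Fin N → ℝ) :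
    gramP P w = Matrix.of w * P * (Matrix.of w)ᵀ := by
  ext a b
  rw [Matrix.mul_assoc, Matrix.mul_apply, gramP, dotProduct]
  refine Finset.sum_congr rfl fun k _ => ?_
  rw [Matrix.mul_apply]
  rfl

/-- The traceless form attached to `P`. -/
def trless {N : ℕ} (d : ℕ) (P : Matrix (Fin N) (Fin N) ℝ) : Matrix (Fin N) (Fin N) ℝ :=
  P - ((d : ℝ) / (N : ℝ)) • 1

theorem trless_form {N d : ℕ} (P : Matrix (Fin N) (Fin N) ℝ) (x : Fin N → ℝ) (hx : x ⬝ᵥ x = 1) :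
    x ⬝ᵥ trless d P *ᵥ x = x ⬝ᵥ P *ᵥ x - (d : ℝ) / (N : ℝ) := by
  simp [trless, Matrix.sub_mulVec, Matrix.smul_mulVec, hx]

theorem gramP_mem {N d : ℕ} (hN : 0 < N) {P : Matrix (Fin N) (Fin N) ℝ} (h1 : Pᵀ = P)
    (h2 : P * P = P) {w : Fin N → Fin N → ℝ} (hw : w ∈ IsoFr (trless d P) N) :
    gramP P w ∈ ProjSet N d := by
  have hW : (Matrix.of w) * (Matrix.of w)ᵀ = 1 := by
    ext a b
    have := hw.1 a b
    simpa [Matrix.mul_apply, dotProduct, Matrix.one_apply] using this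
  have hW' : (Matrix.of w)ᵀ * (Matrix.of w) = 1 := mul_eq_one_comm.1 hW
  refine mem_projSet hN ?_ ?_ fun n => ?_
  · rw [gramP_eq, Matrix.transpose_mul, Matrix.transpose_mul, Matrix.transpose_transpose, h1,
      Matrix.mul_assoc]
  · rw [gramP_eq]
    calc _ = Matrix.of w * (P * ((Matrix.of w)ᵀ * Matrix.of w) * P) * (Matrix.of w)ᵀ := by
          simp only [Matrix.mul_assoc]
      _ = _ := by rw [hW', Matrix.mul_one, h2]
  · have h := hw.2 n
    rw [trless_form _ _ (by simpa using hw.1 n n)] at h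
    unfold gramP
    linarith

theorem gramP_surj {N d : ℕ} {P Q : Matrix (Fin N) (Fin N) ℝ}
    (hP : P ∈ ProjSet N d) (hQ : Q ∈ ProjSet N d) :
    ∃ w ∈ IsoFr (trless d P) N, gramP P w = Q := by
  obtain ⟨W, hW, hQW⟩ := conj_exists hP.1 hP.2.1 hQ.1 hQ.2.1 (by rw [hP.2.2.1, hQ.2.2.1])
  have hg : gramP P W = Q := by rw [hQW]; exact gramP_eq P W
  have ho : ∀ i k, W i ⬝ᵥ W k = if i = k then 1 else 0 := by
    intro i k
    have := congrFun (congrFun hW i) k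
    simpa [Matrix.mul_apply, dotProduct, Matrix.one_apply] using this
  refine ⟨W, ⟨ho, fun i => ?_⟩, hg⟩
  rw [trless_form _ _ (by simpa using ho i i)]
  have := congrFun (congrFun hg i) i
  unfold gramP at this
  rw [this, hQ.2.2.2]; simp

/-- Sign pattern with a single minus. -/
def sg {ι : Type*} [DecidableEq ι] (i a : ι) : ℝ := if a = i then -1 else 1

theorem sg_sq {ι : Type*} [DecidableEq ι] (i a : ι) : sg i a * sg i a = 1 := by
  unfold sg; split_ifs <;> norm_num

/-- Conjugation by a sign. -/
def flipM {N : ℕ} (i : Fin N) (Q : Matrix (Fin N) (Fin N) ℝ) : Matrix (Fin N) (Fin N) ℝ :=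
  fun a b => sg i a * sg i b * Q a b

theorem flipM_flipM {N : ℕ} (i : Fin N) (Q : Matrix (Fin N) (Fin N) ℝ) :
    flipM i (flipM i Q) = Q := by
  ext a b
  simp only [flipM]
  calc _ = (sg i a * sg i a) * (sg i b * sg i b) * Q a b := by ring
    _ = _ := by rw [sg_sq, sg_sq]; ring

theorem flipM_mem {N d : ℕ} (hN : 0 < N) (i : Fin N) {Q : Matrix (Fin N) (Fin N) ℝ}
    (hQ : Q ∈ ProjSet N d) : flipM i Q ∈ ProjSet N d := by
  refine mem_projSet hN ?_ ?_ fun n => ?_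
  · ext a b
    have := congrFun (congrFun hQ.1 a) b
    rw [Matrix.transpose_apply] at this ⊢
    simp only [flipM, this]; ring
  · ext a b
    have := congrFun (congrFun hQ.2.1 a) b
    rw [Matrix.mul_apply] at this ⊢
    simp only [flipM]
    rw [← this, Finset.mul_sum]
    refine Finset.sum_congr rfl fun k _ => ?_
    calc _ = sg i a * sg i b * (Q a k * Q k b) * (sg i k * sg i k) := by ring
      _ = _ := by rw [sg_sq]; ring
  · simp only [flipM, sg_sq, one_mul, hQ.2.2.2]

theorem perm_mem {N d : ℕ} (hN : 0 < N) (σ : Equiv.Perm (Fin N)) {Q : Matrix (Fin N) (Fin N) ℝ}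
    (hQ : Q ∈ ProjSet N d) : Q.submatrix σ σ ∈ ProjSet N d := by
  refine mem_projSet hN ?_ ?_ fun n => ?_
  · rw [Matrix.transpose_submatrix, hQ.1]
  · rw [Matrix.submatrix_mul_equiv, hQ.2.1]
  · exact hQ.2.2.2 _

theorem continuous_flipM {N : ℕ} (i : Fin N) : Continuous (flipM i) := by
  refine continuous_matrix fun a b => ?_
  simp only [flipM]
  exact continuous_const.mul (continuous_id.matrix_elem a b)

theorem gramP_sflip {N : ℕ} (P : Matrix (Fin N) (Fin N) ℝ) (w : Fin N → Fin N → ℝ) (i : Fin N) :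
    gramP P (sflip i w) = flipM i (gramP P w) := by
  have h : ∀ a, sflip i w a = sg i a • w a := by
    intro a
    by_cases ha : a = i
    · subst ha; simp [sflip, sg]
    · simp [sflip, sg, ha]
  ext a b
  simp only [gramP, flipM, h, Matrix.mulVec_smul, smul_dotProduct, dotProduct_smul, smul_eq_mul]
  ring

theorem reduce_symm {N d : ℕ} (hN : 2 ≤ N) {P : Matrix (Fin N) (Fin N) ℝ} (hP : P ∈ ProjSet N d)
    (hflip : ∀ i, JoinedIn (ProjSet N d) P (flipM i P))
    (hswap : ∀ i k, JoinedIn (ProjSet N d) P (P.submatrix (Equiv.swap i k) (Equiv.swap i k))) :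
    ∀ Q ∈ ProjSet N d, JoinedIn (ProjSet N d) P Q := by
  obtain ⟨j, rfl⟩ : ∃ j, N = j + 2 := ⟨N - 2, by omega⟩
  intro Q hQ
  obtain ⟨w0, hw0, hg0⟩ := gramP_surj hP hP
  obtain ⟨w, hw, hg⟩ := gramP_surj hP hQ
  have hpos : 0 < j + 2 := by omega
  have hcont : Continuous (gramP P) := by
    refine continuous_matrix fun a b => ?_
    simp only [gramP, Matrix.mulVec, dotProduct]
    fun_prop
  have main := all_conn (S := trless d P) ?_ ?_
    (fun w w' => JoinedIn (ProjSet (j + 2) d) P (gramP P w) ↔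
      JoinedIn (ProjSet (j + 2) d) P (gramP P w')) ⟨fun _ => Iff.rfl, Iff.symm, Iff.trans⟩
    ?_ ?_ ?_ w0 w hw0 hw
  · rw [hg0, hg] at main
    exact main.1 (JoinedIn.refl hP)
  · simp [trless, hP.1]
  · simp only [trless, Matrix.trace_sub, Matrix.trace_smul, Matrix.trace_one]
    simp only [Matrix.trace, Matrix.diag_apply, hP.2.2.2]
    simp
    ring
  · rintro _ _ ⟨f, hf, rfl, rfl⟩
    have hj : JoinedIn (ProjSet (j + 2) d) (gramP P (f 0)) (gramP P (f 1)) := by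
      refine JoinedIn.ofLine (f := fun t => gramP P (f t)) ?_ rfl rfl ?_
      · exact hcont.comp_continuousOn fun t ht => ((hf t ht).1.continuousAt).continuousWithinAt
      · rintro _ ⟨t, ht, rfl⟩
        exact gramP_mem hpos hP.1 hP.2.1 (hf t ht).2.self_of_nhds
    exact ⟨fun h => h.trans hj, fun h => h.trans hj.symm⟩
  · intro w hw i
    have key : ∀ Q, JoinedIn (ProjSet (j + 2) d) P Q → JoinedIn (ProjSet (j + 2) d) P (flipM i Q) :=
      fun Q h => (hflip i).trans (joined_map h (continuous_flipM i) fun z hz => flipM_mem hpos i hz)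
    rw [gramP_sflip]
    refine ⟨key _, fun h => ?_⟩
    have := key _ h
    rwa [flipM_flipM] at this
  · intro w hw
    have key : ∀ Q, JoinedIn (ProjSet (j + 2) d) P Q →
        JoinedIn (ProjSet (j + 2) d) P (Q.submatrix (Equiv.swap 0 1) (Equiv.swap 0 1)) :=
      fun Q h => (hswap 0 1).trans (joined_map h (f := fun Q => Q.submatrix (Equiv.swap 0 1) (Equiv.swap 0 1))
        (continuous_id.matrix_submatrix _ _) fun z hz => perm_mem hpos _ hz)
    have e : gramP P (w ∘ Equiv.swap 0 1) =
      (gramP P w).submatrix (Equiv.swap 0 1) (Equiv.swap 0 1) := rfl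
    rw [e]
    refine ⟨key _, fun h => ?_⟩
    have := key _ h
    rw [Matrix.submatrix_submatrix] at this
    convert this using 1
    ext a b
    simp

/-- Householder reflection. -/
def hh {d : ℕ} (w : Fin d → ℝ) : Matrix (Fin d) (Fin d) ℝ :=
  1 - (2 / (w ⬝ᵥ w)) • Matrix.vecMulVec w w

theorem hh_symm {d : ℕ} (w : Fin d → ℝ) : (hh w)ᵀ = hh w := by
  simp [hh, Matrix.transpose_vecMulVec]

theorem hh_mulVec {d : ℕ} (w x : Fin d → ℝ) :
    hh w *ᵥ x = x - (2 / (w ⬝ᵥ w) * (w ⬝ᵥ x)) • w := by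
  simp [hh, Matrix.sub_mulVec, Matrix.smul_mulVec, Matrix.vecMulVec_mulVec, smul_smul]

theorem hh_sq {d : ℕ} {w : Fin d → ℝ} (hw : w ≠ 0) : hh w * hh w = 1 := by
  have h0 := (dot_self_pos hw).ne'
  apply Matrix.ext_of_mulVec_single
  intro k
  rw [← Matrix.mulVec_mulVec, hh_mulVec w (hh w *ᵥ _), hh_mulVec, Matrix.one_mulVec]
  simp only [dotProduct_sub, dotProduct_smul, smul_eq_mul]
  have : (2 / (w ⬝ᵥ w) * (w ⬝ᵥ (Pi.single k 1 : Fin d → ℝ) -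
      2 / (w ⬝ᵥ w) * (w ⬝ᵥ (Pi.single k 1 : Fin d → ℝ)) * (w ⬝ᵥ w)))
      = -(2 / (w ⬝ᵥ w) * (w ⬝ᵥ (Pi.single k 1 : Fin d → ℝ))) := by
    field_simp
    ring
  rw [this, neg_smul]
  abel

theorem exists_perp_one {d : ℕ} (hd : 2 ≤ d) (x : Fin d → ℝ) :
    ∃ z : Fin d → ℝ, z ≠ 0 ∧ x ⬝ᵥ z = 0 := by
  let M : Matrix (Fin 1) (Fin d) ℝ := Matrix.of fun _ => x
  have hk : LinearMap.ker M.mulVecLin ≠ ⊥ := by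
    apply LinearMap.ker_ne_bot_of_finrank_lt
    simp
    omega
  obtain ⟨z, hz, hz0⟩ := Submodule.exists_mem_ne_zero_of_ne_bot hk
  refine ⟨z, hz0, ?_⟩
  have := congrFun (LinearMap.mem_ker.1 hz) 0
  simpa [M, Matrix.mulVec] using this

theorem rot_exists {d : ℕ} (hd : 2 ≤ d) {x y : Fin d → ℝ} (hx : x ⬝ᵥ x = 1) (hy : y ⬝ᵥ y = 1) :
    ∃ Q : ℝ → Matrix (Fin d) (Fin d) ℝ, ContinuousOn Q (Set.Icc 0 1) ∧
      (∀ t ∈ Set.Icc (0 : ℝ) 1, Q t * (Q t)ᵀ = 1) ∧ Q 0 = 1 ∧ Q 1 *ᵥ x = y := by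
  by_cases hxy : x = y
  · refine ⟨fun _ => 1, continuousOn_const, fun t _ => by simp, rfl, by simp [hxy]⟩
  obtain ⟨z, hz0, hz⟩ := exists_perp_one hd x
  have hpos : 0 < 1 - x ⬝ᵥ y := by
    have := dot_self_pos (sub_ne_zero.2 hxy)
    simp only [dotProduct_sub, sub_dotProduct, hx, hy, dotProduct_comm y x] at this
    linarith
  let w : ℝ → Fin d → ℝ := fun t => (1 - t) • z + t • (x - y)
  have hw : ∀ t, w t ≠ 0 := by
    intro t ht
    have h1 : x ⬝ᵥ w t = t * (1 - x ⬝ᵥ y) := by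
      simp [w, dotProduct_add, dotProduct_sub, dotProduct_smul, hz, hx]
    rw [ht, dotProduct_zero] at h1
    rcases mul_eq_zero.1 h1.symm with h | h
    · rw [h] at ht
      simp [w] at ht
      exact hz0 ht
    · exact hpos.ne' h
  have hw0 : w 0 = z := by simp [w]
  have hw1 : w 1 = x - y := by simp [w]
  have hcw : Continuous w := by fun_prop
  refine ⟨fun t => hh (w t) * hh z, ?_, fun t _ => ?_, ?_, ?_⟩
  · apply Continuous.continuousOn
    have : Continuous fun t => hh (w t) := by
      refine continuous_matrix fun a b => ?_
      simp only [hh, Matrix.sub_apply, Matrix.smul_apply, Matrix.vecMulVec_apply, smul_eq_mul]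
      have hwa : ∀ a, Continuous fun t => w t a := fun a => (continuous_apply a).comp hcw
      refine continuous_const.sub ((continuous_const.div ?_ fun t => (dot_self_pos (hw t)).ne').mul
        ((hwa a).mul (hwa b)))
      exact continuous_finsetSum _ fun i _ => (hwa i).mul (hwa i)
    exact this.matrix_mul continuous_const
  · rw [Matrix.transpose_mul, hh_symm, hh_symm]
    calc _ = hh (w t) * (hh z * hh z) * hh (w t) := by simp only [Matrix.mul_assoc]
      _ = 1 := by rw [hh_sq hz0, Matrix.mul_one, hh_sq (hw t)]
  · simp only [hw0]; exact hh_sq hz0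
  · simp only [hw1]
    rw [← Matrix.mulVec_mulVec, hh_mulVec z, dotProduct_comm z x, hz, mul_zero, zero_smul, sub_zero,
      hh_mulVec]
    have : 2 / ((x - y) ⬝ᵥ (x - y)) * ((x - y) ⬝ᵥ x) = 1 := by
      simp only [dotProduct_sub, sub_dotProduct, hx, hy, dotProduct_comm y x]
      have : 1 - x ⬝ᵥ y - (x ⬝ᵥ y - 1) ≠ 0 := by linarith
      field_simp
      ring
    rw [this]; simp

/-- Unit norm tight frames with frame constant `c`. -/
def Fr (ι : Type) [Fintype ι] (d : ℕ) (c : ℝ) : Set (ι → Fin d → ℝ) :=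
  {f | (∀ n, f n ⬝ᵥ f n = 1) ∧ ∀ x y, ∑ n, (f n ⬝ᵥ x) * (f n ⬝ᵥ y) = c * (x ⬝ᵥ y)}

/-- Sign change of one vector. -/
def flipF {ι : Type} [DecidableEq ι] {d : ℕ} (i : ι) (f : ι → Fin d → ℝ) : ι → Fin d → ℝ :=
  fun a => sg i a • f a

theorem flipF_mem {ι : Type} [Fintype ι] [DecidableEq ι] {d : ℕ} {c : ℝ} (i : ι)
    {f : ι → Fin d → ℝ} (hf : f ∈ Fr ι d c) : flipF i f ∈ Fr ι d c := by
  refine ⟨fun n => ?_, fun x y => ?_⟩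
  · simp only [flipF, smul_dotProduct, dotProduct_smul, hf.1, smul_eq_mul, mul_one, sg_sq]
  · rw [← hf.2 x y]
    refine Finset.sum_congr rfl fun n _ => ?_
    simp only [flipF, smul_dotProduct, smul_eq_mul]
    calc _ = (sg i n * sg i n) * ((f n ⬝ᵥ x) * (f n ⬝ᵥ y)) := by ring
      _ = _ := by rw [sg_sq, one_mul]

theorem permF_mem {ι : Type} [Fintype ι] {d : ℕ} {c : ℝ} (σ : Equiv.Perm ι)
    {f : ι → Fin d → ℝ} (hf : f ∈ Fr ι d c) : f ∘ σ ∈ Fr ι d c := by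
  refine ⟨fun n => hf.1 _, fun x y => ?_⟩
  rw [← hf.2 x y]
  exact Equiv.sum_comp σ fun n => (f n ⬝ᵥ x) * (f n ⬝ᵥ y)

theorem joined_flipF {ι : Type} [Fintype ι] [DecidableEq ι] {d : ℕ} {c : ℝ} (i : ι)
    {f g : ι → Fin d → ℝ} (h : JoinedIn (Fr ι d c) f g) :
    JoinedIn (Fr ι d c) (flipF i f) (flipF i g) := by
  refine joined_map h ?_ fun z hz => flipF_mem i hz
  unfold flipF
  fun_prop

theorem joined_permF {ι : Type} [Fintype ι] {d : ℕ} {c : ℝ} (σ : Equiv.Perm ι)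
    {f g : ι → Fin d → ℝ} (h : JoinedIn (Fr ι d c) f g) :
    JoinedIn (Fr ι d c) (f ∘ σ) (g ∘ σ) := by
  refine joined_map h (f := fun f => f ∘ σ) ?_ fun z hz => permF_mem σ hz
  exact continuous_pi fun a => continuous_apply _

theorem pair_rot {ι : Type} [Fintype ι] [DecidableEq ι] {d : ℕ} {c : ℝ} {f : ι → Fin d → ℝ}
    (hf : f ∈ Fr ι d c) {x y : ι} (hxy : x ≠ y) (h0 : f x ⬝ᵥ f y = 0) :
    JoinedIn (Fr ι d c) f (flipF y (f ∘ Equiv.swap x y)) := by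
  have h0' : f y ⬝ᵥ f x = 0 := by rw [dotProduct_comm]; exact h0
  let g : ℝ → ι → Fin d → ℝ := fun θ a =>
    if a = x then Real.cos θ • f x + Real.sin θ • f y
    else if a = y then -Real.sin θ • f x + Real.cos θ • f y else f a
  have gx : ∀ θ, g θ x = Real.cos θ • f x + Real.sin θ • f y := fun θ => by simp [g]
  have gy : ∀ θ, g θ y = -Real.sin θ • f x + Real.cos θ • f y := fun θ => by simp [g, hxy.symm]
  have ga : ∀ θ a, a ≠ x → a ≠ y → g θ a = f a := fun θ a h1 h2 => by simp [g, h1, h2]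
  refine JoinedIn.ofLine (f := fun t => g (t * (Real.pi / 2))) ?_ ?_ ?_ ?_
  · apply Continuous.continuousOn
    refine continuous_pi fun a => ?_
    by_cases h1 : a = x
    · subst h1; simp only [gx]; fun_prop
    by_cases h2 : a = y
    · subst h2; simp only [gy]; fun_prop
    simp only [ga _ a h1 h2]; fun_prop
  · funext a
    by_cases h1 : a = x
    · subst h1; simp [gx]
    by_cases h2 : a = y
    · subst h2; simp [gy]
    simp [ga _ a h1 h2]
  · funext a
    by_cases h1 : a = x
    · subst h1; simp [gx, flipF, sg, hxy]
    by_cases h2 : a = y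
    · subst h2; simp [gy, flipF, sg]
    simp [ga _ a h1 h2, flipF, sg, h2, Equiv.swap_apply_of_ne_of_ne h1 h2]
  · rintro _ ⟨t, -, rfl⟩
    simp only
    generalize t * (Real.pi / 2) = θ
    have hcs := Real.sin_sq_add_cos_sq θ
    refine ⟨fun a => ?_, fun u v => ?_⟩
    · by_cases h1 : a = x
      · subst h1
        simp only [gx, add_dotProduct, dotProduct_add, smul_dotProduct, dotProduct_smul, hf.1, h0,
          h0', smul_eq_mul]
        linarith
      by_cases h2 : a = y
      · subst h2
        simp only [gy, add_dotProduct, dotProduct_add, smul_dotProduct, dotProduct_smul, hf.1, h0,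
          h0', smul_eq_mul]
        linarith
      rw [ga _ a h1 h2, hf.1]
    · rw [← hf.2 u v, ← sub_eq_zero, ← Finset.sum_sub_distrib]
      rw [Finset.sum_eq_add x y hxy]
      · simp only [gx, gy, add_dotProduct, smul_dotProduct, smul_eq_mul]
        linear_combination ((f x ⬝ᵥ u) * (f x ⬝ᵥ v) + (f y ⬝ᵥ u) * (f y ⬝ᵥ v)) * hcs
      · rintro a - ⟨h1, h2⟩
        rw [ga _ a h1 h2, sub_self]
      · simp
      · simp

theorem utf_exists {d M : ℕ} (hd : 0 < d) (hM : d ≤ M) : (Fr (Fin M) d ((M : ℝ) / d)).Nonempty := by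
  obtain ⟨r, rfl⟩ := Nat.exists_eq_add_of_le hM
  let D : Fin (d + r) → ℝ := Fin.append (fun _ => 1) (fun _ => 0)
  let S := trless d (Matrix.diagonal D)
  obtain ⟨w, hw⟩ := isoFr_nonempty (S := S) (by simp [S, trless]) (by
    simp only [S, trless, Matrix.trace_sub, Matrix.trace_smul, Matrix.trace_one,
      Matrix.trace_diagonal, Fin.sum_univ_add, D, Fin.append_left, Fin.append_right]
    simp
    have : (d : ℝ) + r ≠ 0 := by positivity
    field_simp
    ring) (d + r) le_rfl
  have hc : 0 < ((d + r : ℕ) : ℝ) / d := by positivity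
  have hsq : √(((d + r : ℕ) : ℝ) / d) * √(((d + r : ℕ) : ℝ) / d) = ((d + r : ℕ) : ℝ) / d :=
    Real.mul_self_sqrt hc.le
  refine ⟨fun n => √(((d + r : ℕ) : ℝ) / d) • fun k => w n (Fin.castAdd r k), fun n => ?_,
    fun x y => ?_⟩
  · have h1 : w n ⬝ᵥ w n = 1 := by simpa using hw.1 n n
    have h2 := hw.2 n
    rw [trless_form _ _ h1] at h2
    have h3 : w n ⬝ᵥ Matrix.diagonal D *ᵥ w n =
        ∑ k, w n (Fin.castAdd r k) * w n (Fin.castAdd r k) := by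
      simp [dotProduct, Matrix.mulVec_diagonal, Fin.sum_univ_add, D]
    rw [h3] at h2
    rw [smul_dotProduct, dotProduct_smul, smul_eq_mul, smul_eq_mul, ← mul_assoc, hsq, dotProduct,
      sub_eq_zero.1 h2]
    have : ((d + r : ℕ) : ℝ) ≠ 0 := by positivity
    field_simp
  · let X : Fin (d + r) → ℝ := Fin.append x (fun _ => 0)
    let Y : Fin (d + r) → ℝ := Fin.append y (fun _ => 0)
    have hX : ∀ n, (fun k => w n (Fin.castAdd r k)) ⬝ᵥ x = w n ⬝ᵥ X := by
      intro n; simp [dotProduct, Fin.sum_univ_add, X]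
    have hY : ∀ n, (fun k => w n (Fin.castAdd r k)) ⬝ᵥ y = w n ⬝ᵥ Y := by
      intro n; simp [dotProduct, Fin.sum_univ_add, Y]
    have hXY : x ⬝ᵥ y = X ⬝ᵥ Y := by simp [dotProduct, Fin.sum_univ_add, X, Y]
    have h4 : X ⬝ᵥ Y = ∑ n, (w n ⬝ᵥ X) * (w n ⬝ᵥ Y) := by
      conv_lhs => rw [cproj_full hw Y]
      rw [dotProduct_sum]
      refine Finset.sum_congr rfl fun n _ => ?_
      rw [dotProduct_smul, dotProduct_comm X, smul_eq_mul, mul_comm]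
    rw [hXY, h4, Finset.mul_sum]
    refine Finset.sum_congr rfl fun n _ => ?_
    rw [smul_dotProduct, smul_dotProduct, hX, hY, smul_eq_mul, smul_eq_mul]
    linear_combination ((w n ⬝ᵥ X) * (w n ⬝ᵥ Y)) * hsq

/-- The standard basis together with a second tight frame. -/
def baseF {d M : ℕ} (F : Fin M → Fin d → ℝ) : Fin d ⊕ Fin M → Fin d → ℝ :=
  Sum.elim (fun i => Pi.single i 1) F

theorem baseF_mem {d M : ℕ} {c : ℝ} {F : Fin M → Fin d → ℝ} (hF : F ∈ Fr (Fin M) d c) :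
    baseF F ∈ Fr (Fin d ⊕ Fin M) d (1 + c) := by
  refine ⟨fun n => ?_, fun x y => ?_⟩
  · rcases n with i | n
    · simp [baseF]
    · simpa [baseF] using hF.1 n
  · rw [Fintype.sum_sum_type]
    simp only [baseF, Sum.elim_inl, Sum.elim_inr, hF.2]
    rw [add_mul, one_mul]
    simp only [single_dotProduct, one_mul]
    rfl

theorem base_rot {d M : ℕ} (hd : 2 ≤ d) {c : ℝ} {F : Fin M → Fin d → ℝ}
    (hF : F ∈ Fr (Fin M) d c) (n : Fin M) (y : Fin d → ℝ) (hy : y ⬝ᵥ y = 1) :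
    ∃ G : Fin M → Fin d → ℝ, G n = y ∧ G ∈ Fr (Fin M) d c ∧
      JoinedIn (Fr (Fin d ⊕ Fin M) d (1 + c)) (baseF F) (baseF G) := by
  obtain ⟨Q, hQc, hQ, hQ0, hQ1⟩ := rot_exists hd (hF.1 n) hy
  have hm : ∀ t ∈ Set.Icc (0 : ℝ) 1, (fun n => Q t *ᵥ F n) ∈ Fr (Fin M) d c := by
    intro t ht
    have h1 := hQ t ht
    have h2 : (Q t)ᵀ * Q t = 1 := mul_eq_one_comm.1 h1
    have hdot : ∀ u v, (Q t *ᵥ u) ⬝ᵥ v = u ⬝ᵥ ((Q t)ᵀ *ᵥ v) := by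
      intro u v
      rw [Matrix.dotProduct_mulVec, ← Matrix.mulVec_transpose, Matrix.transpose_transpose]
    refine ⟨fun n => ?_, fun x y => ?_⟩
    · rw [hdot, Matrix.mulVec_mulVec, h2, Matrix.one_mulVec, hF.1]
    · simp only [hdot]
      rw [hF.2, ← hdot, Matrix.mulVec_mulVec, h1, Matrix.one_mulVec]
  refine ⟨fun n => Q 1 *ᵥ F n, hQ1, hm 1 (by simp), ?_⟩
  refine JoinedIn.ofLine (f := fun t => baseF fun n => Q t *ᵥ F n) ?_ ?_ rfl ?_
  · rw [continuousOn_pi]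
    rintro (i | n)
    · simp only [baseF, Sum.elim_inl]; exact continuousOn_const
    · simp only [baseF, Sum.elim_inr]
      have : Continuous fun A : Matrix (Fin d) (Fin d) ℝ => A *ᵥ F n :=
        continuous_id.matrix_mulVec continuous_const
      exact this.comp_continuousOn hQc
  · simp [hQ0]
  · rintro _ ⟨t, ht, rfl⟩
    exact baseF_mem (hm t ht)

theorem base_swap {d M : ℕ} (hd : 2 ≤ d) {c : ℝ} {F : Fin M → Fin d → ℝ}
    (hF : F ∈ Fr (Fin M) d c) (i : Fin d) (n : Fin M) :
    JoinedIn (Fr (Fin d ⊕ Fin M) d (1 + c)) (baseF F)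
      (baseF F ∘ Equiv.swap (Sum.inl i) (Sum.inr n)) := by
  obtain ⟨G, hG1, hG, hJ⟩ := base_rot hd hF n (Pi.single i 1) (by simp)
  have h1 := joined_permF (Equiv.swap (Sum.inl i) (Sum.inr n)) hJ
  have h2 : baseF G ∘ Equiv.swap (Sum.inl i) (Sum.inr n) = baseF G := by
    funext a
    by_cases ha : a = Sum.inl i
    · subst ha; simp [baseF, hG1]
    by_cases hb : a = Sum.inr n
    · subst hb; simp [baseF, hG1]
    rw [Function.comp_apply, Equiv.swap_apply_of_ne_of_ne ha hb]
  rw [h2] at h1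
  exact hJ.trans h1.symm

theorem base_flip {d M : ℕ} (hd : 2 ≤ d) (hM : 0 < M) {c : ℝ} {F : Fin M → Fin d → ℝ}
    (hF : F ∈ Fr (Fin M) d c) (a : Fin d ⊕ Fin M) :
    JoinedIn (Fr (Fin d ⊕ Fin M) d (1 + c)) (baseF F) (flipF a (baseF F)) := by
  have key : ∀ x y : Fin d ⊕ Fin M, x ≠ y → ∀ G : Fin M → Fin d → ℝ, G ∈ Fr (Fin M) d c →
      JoinedIn (Fr (Fin d ⊕ Fin M) d (1 + c)) (baseF F) (baseF G) →
      baseF G x ⬝ᵥ baseF G y = 0 →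
      JoinedIn (Fr (Fin d ⊕ Fin M) d (1 + c)) (baseF F) (baseF F ∘ Equiv.swap x y) →
      JoinedIn (Fr (Fin d ⊕ Fin M) d (1 + c)) (baseF F) (flipF y (baseF F)) := by
    intro x y hxy G hG hJ h0 hs
    have h1 := pair_rot (baseF_mem hG) hxy h0
    have h2 := joined_flipF y (joined_permF (Equiv.swap x y) hJ)
    have h3 := joined_flipF y hs
    exact hJ.trans (h1.trans (h2.symm.trans h3.symm))
  have hk : ∀ i : Fin d, ∃ k : Fin d, k ≠ i := by
    intro i
    by_cases h : i = ⟨0, by omega⟩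
    · exact ⟨⟨1, by omega⟩, by rw [h]; simp⟩
    · exact ⟨⟨0, by omega⟩, fun h' => h h'.symm⟩
  rcases a with i | n
  · obtain ⟨k, hki⟩ := hk i
    obtain ⟨G, hG1, hG, hJ⟩ := base_rot hd hF ⟨0, hM⟩ (Pi.single k 1) (by simp)
    refine key (Sum.inr ⟨0, hM⟩) (Sum.inl i) (by simp) G hG hJ ?_ ?_
    · simp [baseF, hG1, hki]
    · rw [Equiv.swap_comm]; exact base_swap hd hF i _
  · obtain ⟨k, hki⟩ := hk ⟨0, by omega⟩
    obtain ⟨G, hG1, hG, hJ⟩ := base_rot hd hF n (Pi.single k 1) (by simp)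
    refine key (Sum.inl ⟨0, by omega⟩) (Sum.inr n) (by simp) G hG hJ ?_ (base_swap hd hF _ n)
    simp [baseF, hG1, hki.symm]

theorem base_swap_all {d M : ℕ} (hd : 2 ≤ d) (hM : 0 < M) {c : ℝ} {F : Fin M → Fin d → ℝ}
    (hF : F ∈ Fr (Fin M) d c) (a b : Fin d ⊕ Fin M) :
    JoinedIn (Fr (Fin d ⊕ Fin M) d (1 + c)) (baseF F) (baseF F ∘ Equiv.swap a b) := by
  have comp : ∀ σ τ : Equiv.Perm (Fin d ⊕ Fin M),
      JoinedIn (Fr (Fin d ⊕ Fin M) d (1 + c)) (baseF F) (baseF F ∘ σ) →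
      JoinedIn (Fr (Fin d ⊕ Fin M) d (1 + c)) (baseF F) (baseF F ∘ τ) →
      JoinedIn (Fr (Fin d ⊕ Fin M) d (1 + c)) (baseF F) (baseF F ∘ (σ * τ : Equiv.Perm _)) := by
    intro σ τ h1 h2
    have := joined_permF τ h1
    exact h2.trans this
  have hLR := base_swap hd hF
  have hRL : ∀ n i, JoinedIn (Fr (Fin d ⊕ Fin M) d (1 + c)) (baseF F)
      (baseF F ∘ Equiv.swap (Sum.inr n) (Sum.inl i)) := fun n i => by
    rw [Equiv.swap_comm]; exact hLR i n
  by_cases hab : a = b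
  · subst hab
    rw [Equiv.swap_self]
    exact JoinedIn.refl (baseF_mem hF)
  rcases a with i | n <;> rcases b with k | m
  · rw [← Equiv.swap_mul_swap_mul_swap (x := Sum.inl k) (y := Sum.inr ⟨0, hM⟩) (z := Sum.inl i)
      (by simp) (fun h => hab h.symm)]
    exact comp _ _ (comp _ _ (hRL _ _) (hLR _ _)) (hRL _ _)
  · exact hLR _ _
  · exact hRL _ _
  · rw [← Equiv.swap_mul_swap_mul_swap (x := Sum.inr m) (y := Sum.inl ⟨0, by omega⟩)
      (z := Sum.inr n) (by simp) (fun h => hab h.symm)]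
    exact comp _ _ (comp _ _ (hLR _ _) (hRL _ _)) (hLR _ _)

theorem conn_big {N d : ℕ} (hd : 2 ≤ d) (hN : 2 * d ≤ N) : IsPathConnected (ProjSet N d) := by
  obtain ⟨M, rfl⟩ : ∃ M, N = d + M := ⟨N - d, by omega⟩
  obtain ⟨F, hF⟩ := utf_exists (d := d) (M := M) (by omega) (by omega)
  let e : Fin (d + M) ≃ Fin d ⊕ Fin M := finSumFinEquiv.symm
  let G : (Fin d ⊕ Fin M → Fin d → ℝ) → Matrix (Fin (d + M)) (Fin (d + M)) ℝ :=
    fun f a b => ((d : ℝ) / ((d + M : ℕ) : ℝ)) * (f (e a) ⬝ᵥ f (e b))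
  have hpos : 0 < d + M := by omega
  have hd0 : (d : ℝ) ≠ 0 := by positivity
  have hN0 : ((d + M : ℕ) : ℝ) ≠ 0 := by positivity
  have hGc : Continuous G := by
    refine continuous_matrix fun a b => ?_
    simp only [G, dotProduct]
    fun_prop
  have hGm : ∀ f ∈ Fr (Fin d ⊕ Fin M) d (1 + (M : ℝ) / d), G f ∈ ProjSet (d + M) d := by
    intro f hf
    refine mem_projSet hpos ?_ ?_ fun n => ?_
    · ext a b
      rw [Matrix.transpose_apply]
      simp only [G]
      rw [dotProduct_comm]
    · ext a b
      rw [Matrix.mul_apply]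
      simp only [G]
      have h1 : ∑ n : Fin (d + M), (f (e n) ⬝ᵥ f (e a)) * (f (e n) ⬝ᵥ f (e b)) =
          (1 + (M : ℝ) / d) * (f (e a) ⬝ᵥ f (e b)) := by
        rw [← hf.2]
        exact Equiv.sum_comp e fun n => (f n ⬝ᵥ f (e a)) * (f n ⬝ᵥ f (e b))
      calc _ = ((d : ℝ) / ((d + M : ℕ) : ℝ)) * ((d : ℝ) / ((d + M : ℕ) : ℝ)) *
            ∑ n : Fin (d + M), (f (e n) ⬝ᵥ f (e a)) * (f (e n) ⬝ᵥ f (e b)) := by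
            rw [Finset.mul_sum]
            refine Finset.sum_congr rfl fun n _ => ?_
            rw [dotProduct_comm (f (e a)) (f (e n))]
            ring
        _ = _ := by
          rw [h1]
          push_cast at hN0 ⊢
          field_simp
    · simp [G, hf.1]
  have hP := hGm _ (baseF_mem hF)
  refine ⟨G (baseF F), hP, fun {Q} hQ => reduce_symm (by omega) hP (fun i => ?_) (fun i k => ?_) Q hQ⟩
  · have h := joined_map (base_flip hd (by omega) hF (e i)) hGc hGm
    convert h using 1
    ext a b
    have hs : ∀ a, sg (e i) (e a) = sg i a := by intro a; simp [sg]
    simp only [flipM, G, flipF, smul_dotProduct, dotProduct_smul, smul_eq_mul, hs]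
    ring
  · have h := joined_map (base_swap_all hd (by omega) hF (e i) (e k)) hGc hGm
    convert h using 1
    ext a b
    have hs : ∀ a, Equiv.swap (e i) (e k) (e a) = e (Equiv.swap i k a) := by
      intro a
      have := (e.injective.swap_apply i k a)
      exact this
    rw [Matrix.submatrix_apply]
    simp only [G, Function.comp_apply, hs]

theorem one_sub_mem {N d : ℕ} (hN : 0 < N) (hd : d ≤ N) {P : Matrix (Fin N) (Fin N) ℝ}
    (hP : P ∈ ProjSet N d) : 1 - P ∈ ProjSet N (N - d) := by
  refine mem_projSet hN ?_ ?_ fun n => ?_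
  · rw [Matrix.transpose_sub, Matrix.transpose_one, hP.1]
  · rw [Matrix.sub_mul, Matrix.mul_sub, Matrix.mul_sub, hP.2.1]
    simp
  · rw [Matrix.sub_apply, hP.2.2.2, Matrix.one_apply_eq, Nat.cast_sub hd]
    have : (N : ℝ) ≠ 0 := by positivity
    field_simp

/-- `𝓖_{N,d}^ℝ` is path-connected for `N ≥ d + 2 ≥ 4`. -/
theorem projSet_real_pathConnected (N d : ℕ) (hd : 2 ≤ d) (hN : d + 2 ≤ N) :
    IsPathConnected (ProjSet N d) := by
  by_cases h : 2 * d ≤ N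
  · exact conn_big hd h
  · have h1 := conn_big (N := N) (d := N - d) (by omega) (by omega)
    have h2 := h1.image (f := fun P => 1 - P) (continuous_const.sub continuous_id)
    convert h2 using 1
    ext P
    constructor
    · intro hP
      exact ⟨1 - P, one_sub_mem (by omega) (by omega) hP, sub_sub_cancel _ _⟩
    · rintro ⟨Q, hQ, rfl⟩
      have := one_sub_mem (by omega) (by omega) hQ
      rwa [Nat.sub_sub_self (by omega)] at this
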